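/- Let Q be a nondegenerate probability distribution on ℝ with finite first moment and distribution function G. Let F be a distribution function with log-density φ ∈ Φ(1) (i.e. F(x) = ∫_{−∞}^x e^{φ(t)} dt). Then φ = ψ(·|Q) if and only if: ∫_{−∞}^{∞} (F(t) − G(t)) dt = 0, and ∫_{−∞}^{x} (F(t) − G(t)) dt ≤ 0 for all x ∈ ℝ, with equality ∫_{−∞}^{x} (F(t) − G(t)) dt = 0 for every x ∈ S(φ), where S(φ) := { x ∈ dom(φ) : φ(x) > (φ(x − δ) + φ(x + δ))/2 for all δ > 0 }. -/

import Mathlib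

open MeasureTheory Filter Topology Set
open scoped ENNReal RealInnerProductSpace BoundedContinuousFunction

noncomputable section

/-- Truncation of an extended real number to `ℝ≥0∞`. -/
def EReal.toENN (x : EReal) : ℝ≥0∞ := if x = ⊤ then ⊤ else ENNReal.ofReal x.toReal

/-- The real-valued exponential of an extended real number (`⊤` is sent to `0`,
but this value is never used for functions in the class `Φ`). -/
def EReal.expR (x : EReal) : ℝ := (EReal.exp x).toReal

/-- The class `Φ(d)`: upper semicontinuous, concave functions `φ : E → [-∞, ∞)`
which are coercive in the sense that `φ x → -∞` as `‖x‖ → ∞`. -/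
def IsPhi {E : Type*} [NormedAddCommGroup E] [NormedSpace ℝ E] (φ : E → EReal) : Prop :=
  UpperSemicontinuous φ ∧ (∀ x, φ x ≠ ⊤) ∧
  (∀ x y : E, ∀ a b : ℝ, 0 < a → 0 < b → a + b = 1 →
    (a : EReal) * φ x + (b : EReal) * φ y ≤ φ (a • x + b • y)) ∧
  Tendsto φ (Filter.comap (fun x : E => ‖x‖) atTop) (𝓝 ⊥)

/-- The integral of an `EReal`-valued function with respect to a measure,
defined as the difference of the integrals of the positive and negative parts. -/
def eint {E : Type*} [MeasurableSpace E] (Q : Measure E) (φ : E → EReal) : EReal :=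
  ((∫⁻ x, (φ x).toENN ∂Q : ℝ≥0∞) : EReal) - ((∫⁻ x, (-(φ x)).toENN ∂Q : ℝ≥0∞) : EReal)

/-- The log-likelihood-type functional `L(φ, Q) = ∫ φ dQ - ∫ e^{φ(x)} dx + 1`. -/
def Lfun {E : Type*} [NormedAddCommGroup E] [NormedSpace ℝ E] [MeasureSpace E]
    (φ : E → EReal) (Q : Measure E) : EReal :=
  eint Q φ - ((∫⁻ x, EReal.exp (φ x) : ℝ≥0∞) : EReal) + 1

/-- The profile log-likelihood `L(Q) = sup_{φ ∈ Φ} L(φ, Q)`. -/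
def Lprof {E : Type*} [NormedAddCommGroup E] [NormedSpace ℝ E] [MeasureSpace E]
    (Q : Measure E) : EReal :=
  ⨆ φ ∈ {φ : E → EReal | IsPhi φ}, Lfun φ Q

/-- The convex support of a measure: the intersection of all closed convex sets of full
measure. -/
def csupp {E : Type*} [NormedAddCommGroup E] [NormedSpace ℝ E] [MeasurableSpace E]
    (Q : Measure E) : Set E :=
  ⋂₀ {C : Set E | IsClosed C ∧ Convex ℝ C ∧ Q C = 1}

/-- `ψ` is the (a) maximizer of `L(·, Q)` over `Φ`, i.e. `ψ = ψ(·|Q)`. -/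
def IsMLE {E : Type*} [NormedAddCommGroup E] [NormedSpace ℝ E] [MeasureSpace E]
    (Q : Measure E) (ψ : E → EReal) : Prop :=
  IsPhi ψ ∧ ∀ φ : E → EReal, IsPhi φ → Lfun φ Q ≤ Lfun ψ Q

/-- Weak convergence of a sequence of measures. -/
def WConv {E : Type*} [NormedAddCommGroup E] [MeasurableSpace E]
    (Qn : ℕ → Measure E) (Q : Measure E) : Prop :=
  ∀ g : E →ᵇ ℝ, Tendsto (fun n => ∫ x, g x ∂(Qn n)) atTop (𝓝 (∫ x, g x ∂Q))

/-- The Mallows (Wasserstein-1, Kantorovich–Rubinstein) distance. -/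
def D1 {E : Type*} [NormedAddCommGroup E] [MeasurableSpace E] (Q Q' : Measure E) : ℝ :=
  sSup {r : ℝ | ∃ h : E → ℝ, LipschitzWith 1 h ∧ r = |(∫ x, h x ∂Q) - ∫ x, h x ∂Q'|}

/-- The bounded Lipschitz distance. -/
def DBL (Q Q' : Measure ℝ) : ℝ :=
  sSup {r : ℝ | ∃ h : ℝ → ℝ, (∀ x, |h x| ≤ 1) ∧ LipschitzWith 1 h ∧
    r = |(∫ x, h x ∂Q) - ∫ x, h x ∂Q'|}

/-- The Kolmogorov–Smirnov distance. -/
def DKS (Q Q' : Measure ℝ) : ℝ :=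
  ⨆ t : ℝ, |(Q' (Set.Iic t)).toReal - (Q (Set.Iic t)).toReal|

/-- Convolution of two measures. -/
def mconv {E : Type*} [NormedAddCommGroup E] [MeasurableSpace E] (Q R : Measure E) : Measure E :=
  (Q.prod R).map (fun p => p.1 + p.2)

/-- The empirical measure of a finite tuple of real numbers. -/
def empQ {n : ℕ} (v : Fin n → ℝ) : Measure ℝ :=
  ((n : ℝ≥0∞))⁻¹ • ∑ i, Measure.dirac (v i)

end

/-- Kernel in the layer-cake formula for expectations. -/
noncomputable def kern (y t : ℝ) : ℝ := (Ioi t).indicator 1 y - (Iio (0:ℝ)).indicator 1 t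

lemma kern_intervalIntegral (g : ℝ → ℝ) (y : ℝ) (hg : ∀ a b, IntervalIntegrable g volume a b) :
    Integrable (fun t => g t * kern y t) ∧ ∫ t, g t * kern y t = ∫ t in (0:ℝ)..y, g t := by
  rcases le_total 0 y with h | h
  · have e : (fun t => g t * kern y t) = (Ico 0 y).indicator g := by
      ext t
      simp only [kern, indicator, mem_Ioi, mem_Iio, mem_Ico, Pi.one_apply]
      grind
    rw [e, intervalIntegral.integral_of_le h, integral_indicator measurableSet_Ico,
      integral_Ico_eq_integral_Ioo, integral_Ioc_eq_integral_Ioo]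
    refine ⟨?_, rfl⟩
    rw [integrable_indicator_iff measurableSet_Ico]
    exact ((intervalIntegrable_iff_integrableOn_Ico_of_le h).1 (hg 0 y))
  · have e : (fun t => g t * kern y t) = (Ico y 0).indicator (fun t => - g t) := by
      ext t
      simp only [kern, indicator, mem_Ioi, mem_Iio, mem_Ico, Pi.one_apply]
      grind
    rw [e, intervalIntegral.integral_of_ge h, integral_indicator measurableSet_Ico,
      integral_Ico_eq_integral_Ioo, integral_Ioc_eq_integral_Ioo, integral_neg]
    refine ⟨?_, rfl⟩
    rw [integrable_indicator_iff measurableSet_Ico]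
    exact ((intervalIntegrable_iff_integrableOn_Ico_of_le h).1 (hg y 0)).neg

lemma measurable_kern : Measurable (fun p : ℝ × ℝ => kern p.1 p.2) := by
  unfold kern
  apply Measurable.sub
  · have : (fun p : ℝ × ℝ => (Ioi p.2).indicator (1 : ℝ → ℝ) p.1)
        = ({p : ℝ × ℝ | p.2 < p.1}).indicator 1 := by
      ext p; simp [indicator]
    rw [this]
    exact measurable_one.indicator (measurableSet_lt measurable_snd measurable_fst)
  · exact (measurable_one.indicator measurableSet_Iio).comp measurable_snd

lemma abs_kern_integral (y : ℝ) : Integrable (fun t => kern y t) ∧ ∫ t, ‖kern y t‖ = |y| := by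
  have h1 := kern_intervalIntegral (fun _ => 1) y (fun a b => by simp)
  simp only [one_mul] at h1
  refine ⟨h1.1, ?_⟩
  rcases le_total 0 y with h | h
  · have : ∀ t, ‖kern y t‖ = kern y t := by
      intro t
      rw [Real.norm_eq_abs, abs_of_nonneg]
      simp only [kern, indicator, mem_Ioi, mem_Iio, Pi.one_apply]
      grind
    simp [this, h1.2, abs_of_nonneg h]
  · have : ∀ t, ‖kern y t‖ = - kern y t := by
      intro t
      rw [Real.norm_eq_abs, abs_of_nonpos]
      simp only [kern, indicator, mem_Ioi, mem_Iio, Pi.one_apply]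
      grind
    simp [this, h1.2, abs_of_nonpos h, integral_neg]

lemma kern_prod_integrable (μ : Measure ℝ) [IsProbabilityMeasure μ] (hμ : Integrable (fun x : ℝ => x) μ)
    (g : ℝ → ℝ) (hg : Measurable g) (M : ℝ) (hM : ∀ t, |g t| ≤ M) :
    Integrable (fun p : ℝ × ℝ => g p.2 * kern p.1 p.2) (μ.prod volume) := by
  have h : Integrable (fun p : ℝ × ℝ => kern p.1 p.2) (μ.prod volume) := by
    rw [integrable_prod_iff measurable_kern.aestronglyMeasurable]
    refine ⟨Eventually.of_forall fun y => (abs_kern_integral y).1, ?_⟩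
    simp only [(abs_kern_integral _).2]
    exact hμ.abs
  refine h.bdd_mul (c := M) (hg.comp measurable_snd).aestronglyMeasurable ?_
  exact Eventually.of_forall fun p => hM p.2

lemma integral_kern (μ : Measure ℝ) [IsProbabilityMeasure μ] (t : ℝ) :
    ∫ y, kern y t ∂μ = 1 - (μ (Iic t)).toReal - (Iio (0:ℝ)).indicator 1 t := by
  unfold kern
  rw [integral_sub]
  · rw [integral_indicator_one measurableSet_Ioi]
    simp only [integral_const, probReal_univ, smul_eq_mul, one_mul]
    congr 1
    have : Ioi t = (Iic t)ᶜ := by simp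
    rw [this, probReal_compl_eq_one_sub measurableSet_Iic]
    rfl
  · exact (integrable_const (1:ℝ)).indicator measurableSet_Ioi
  · exact integrable_const _

lemma expect_formula (μ : Measure ℝ) [IsProbabilityMeasure μ] (hμ : Integrable (fun x : ℝ => x) μ)
    (g : ℝ → ℝ) (hg : Measurable g) (M : ℝ) (hM : ∀ t, |g t| ≤ M) (f : ℝ → ℝ)
    (hf : ∀ y, f y = f 0 + ∫ t in (0:ℝ)..y, g t) :
    Integrable f μ ∧
    Integrable (fun t => g t * (1 - (μ (Iic t)).toReal - (Iio (0:ℝ)).indicator 1 t)) ∧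
    ∫ y, f y ∂μ = f 0 + ∫ t, g t * (1 - (μ (Iic t)).toReal - (Iio (0:ℝ)).indicator 1 t) := by
  have hgi : ∀ a b, IntervalIntegrable g volume a b := by
    intro a b
    refine (intervalIntegrable_const (c := M)).mono_fun' hg.aestronglyMeasurable ?_
    exact Eventually.of_forall fun t => hM t
  have hp := kern_prod_integrable μ hμ g hg M hM
  have e : f = fun y => f 0 + ∫ t, g t * kern y t := by
    ext y; rw [hf y, (kern_intervalIntegral g y hgi).2]
  have h1 := hp.integral_prod_left
  have h2 := hp.integral_prod_right
  have h3 := integral_integral_swap (f := fun y t => g t * kern y t) hp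
  simp only [integral_const_mul, integral_kern] at h2 h3
  refine ⟨?_, h2, ?_⟩
  · rw [e]; exact (integrable_const _).add h1
  · rw [e]
    rw [integral_add (integrable_const _) h1]
    simp only [integral_const, probReal_univ, smul_eq_mul, one_mul]
    rw [h3]
    congr 1
    have := (kern_intervalIntegral g 0 hgi).2
    rw [this]; simp

/-- Difference of the two expectations of a function with bounded derivative `g`. -/
lemma expect_diff (P Q : Measure ℝ) [IsProbabilityMeasure P] [IsProbabilityMeasure Q]
    (hP : Integrable (fun x : ℝ => x) P) (hQ : Integrable (fun x : ℝ => x) Q)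
    (g : ℝ → ℝ) (hg : Measurable g) (M : ℝ) (hM : ∀ t, |g t| ≤ M) (f : ℝ → ℝ)
    (hf : ∀ y, f y = f 0 + ∫ t in (0:ℝ)..y, g t) :
    Integrable f P ∧ Integrable f Q ∧
    ∫ y, f y ∂Q - ∫ y, f y ∂P = ∫ t, g t * ((P (Iic t)).toReal - (Q (Iic t)).toReal) := by
  obtain ⟨a1, a2, a3⟩ := expect_formula P hP g hg M hM f hf
  obtain ⟨b1, b2, b3⟩ := expect_formula Q hQ g hg M hM f hf
  refine ⟨a1, b1, ?_⟩
  rw [a3, b3, add_sub_add_left_eq_sub, ← integral_sub b2 a2]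
  congr 1
  ext t; ring

lemma cdf_diff_integrable (P Q : Measure ℝ) [IsProbabilityMeasure P] [IsProbabilityMeasure Q]
    (hP : Integrable (fun x : ℝ => x) P) (hQ : Integrable (fun x : ℝ => x) Q) :
    Integrable (fun t => (P (Iic t)).toReal - (Q (Iic t)).toReal) := by
  obtain ⟨a1, a2, a3⟩ := expect_formula P hP (fun _ => 1) measurable_const 1 (by simp)
    (fun x => x) (by simp)
  obtain ⟨b1, b2, b3⟩ := expect_formula Q hQ (fun _ => 1) measurable_const 1 (by simp)
    (fun x => x) (by simp)
  refine (b2.sub a2).congr (Eventually.of_forall fun t => ?_)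
  simp

lemma mean_diff (P Q : Measure ℝ) [IsProbabilityMeasure P] [IsProbabilityMeasure Q]
    (hP : Integrable (fun x : ℝ => x) P) (hQ : Integrable (fun x : ℝ => x) Q) :
    ∫ y, y ∂Q - ∫ y, y ∂P = ∫ t, ((P (Iic t)).toReal - (Q (Iic t)).toReal) := by
  have := (expect_diff P Q hP hQ (fun _ => 1) measurable_const 1 (by simp)
    (fun x => x) (by simp)).2.2
  simpa using this

lemma hinge_diff (P Q : Measure ℝ) [IsProbabilityMeasure P] [IsProbabilityMeasure Q]
    (hP : Integrable (fun x : ℝ => x) P) (hQ : Integrable (fun x : ℝ => x) Q) (x : ℝ) :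
    Integrable (fun y => min (y - x) 0) P ∧ Integrable (fun y => min (y - x) 0) Q ∧
    ∫ y, min (y - x) 0 ∂Q - ∫ y, min (y - x) 0 ∂P
      = ∫ t in Iic x, ((P (Iic t)).toReal - (Q (Iic t)).toReal) := by
  obtain ⟨h1, h2, h3⟩ := expect_diff P Q hP hQ ((Iic x).indicator 1)
    (measurable_one.indicator measurableSet_Iic) 1
    (fun t => by simp only [indicator, Pi.one_apply]; split_ifs <;> simp)
    (fun y => min (y - x) 0) (by
      intro y
      have key : ∀ y, ∫ t in x..y, (Iic x).indicator (1:ℝ → ℝ) t = min (y - x) 0 := by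
        intro y
        rcases le_total x y with h | h
        · rw [intervalIntegral.integral_of_le h, min_eq_right (by linarith),
            setIntegral_indicator measurableSet_Iic]
          have : Ioc x y ∩ Iic x = ∅ := by ext; simp
          simp [this]
        · rw [intervalIntegral.integral_of_ge h, min_eq_left (by linarith),
            setIntegral_indicator measurableSet_Iic]
          have : Ioc y x ∩ Iic x = Ioc y x := by ext; simp
          simp [this, h]
      have hi : ∀ a b, IntervalIntegrable ((Iic x).indicator (1:ℝ → ℝ)) volume a b := by
        intro a b
        refine (intervalIntegrable_const (c := (1:ℝ))).mono_fun'
          (measurable_one.indicator measurableSet_Iic).aestronglyMeasurable ?_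
        exact Eventually.of_forall fun t => by
          simp only [indicator, Pi.one_apply]; split_ifs <;> simp
      have := intervalIntegral.integral_add_adjacent_intervals (hi x 0) (hi 0 y)
      rw [key, key] at this
      linarith)
  refine ⟨h1, h2, ?_⟩
  rw [h3, ← integral_indicator measurableSet_Iic]
  congr 1
  ext t
  simp only [indicator, Pi.one_apply]; split_ifs <;> simp

lemma layer_cake (D : ℝ → ℝ) (hD : Integrable D) (hD0 : ∫ t, D t = 0) (g : ℝ → ℝ) (hg : Measurable g)
    (M : ℝ) (hM : ∀ t, |g t| ≤ M) :
    IntervalIntegrable (fun r => ∫ t in {t | g t ≤ r}, D t) volume (-M) M ∧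
    ∫ t, g t * D t = - ∫ r in (-M)..M, ∫ t in {t | g t ≤ r}, D t := by
  have hM0 : 0 ≤ M := (abs_nonneg _).trans (hM 0)
  have hmm : -M ≤ M := by linarith
  let k : ℝ × ℝ → ℝ := {p : ℝ × ℝ | g p.2 ≤ p.1}.indicator 1
  have hk : Measurable k := measurable_one.indicator
    (measurableSet_le (hg.comp measurable_snd) measurable_fst)
  have hk1 : ∀ p, ‖k p‖ ≤ 1 := by
    intro p; simp only [k, indicator, Pi.one_apply]; split_ifs <;> simp
  have hp : Integrable (fun p : ℝ × ℝ => k p * D p.2) ((volume.restrict (Ioc (-M) M)).prod volume) := by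
    refine Integrable.bdd_mul (c := 1) ?_ hk.aestronglyMeasurable (Eventually.of_forall hk1)
    exact hD.comp_snd _
  have e1 : ∀ r, ∫ t in {t | g t ≤ r}, D t = ∫ t, k (r, t) * D t := by
    intro r
    rw [← integral_indicator (measurableSet_le hg measurable_const)]
    congr 1; ext t
    simp only [k, indicator, mem_ofPred_eq, Pi.one_apply]; split_ifs <;> simp
  have e2 : ∀ t, ∫ r in Ioc (-M) M, k (r, t) = M - g t := by
    intro t
    have h := abs_le.1 (hM t)
    have : (fun r => k (r, t)) = (Ici (g t)).indicator 1 := by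
      ext r; simp [k, indicator]
    rw [this, setIntegral_indicator measurableSet_Ici]
    have : (Ioc (-M) M ∩ Ici (g t) : Set ℝ) =ᵐ[volume] Ioc (g t) M := by
      have h1 : (Ioc (-M) M ∩ Ici (g t) : Set ℝ) =ᵐ[volume] (Ioc (-M) M ∩ Ioi (g t) : Set ℝ) :=
        (ae_eq_refl _).inter Ioi_ae_eq_Ici.symm
      refine h1.trans ?_
      have : (Ioc (-M) M ∩ Ioi (g t) : Set ℝ) = Ioc (g t) M := by
        ext; simp; grind
      rw [this]
      exact ae_eq_refl _
    rw [setIntegral_congr_set this]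
    simp [h.2]
  have hl := hp.integral_prod_left
  have hs := integral_integral_swap (f := fun r t => k (r, t) * D t) hp
  simp only [integral_mul_const, e2] at hs
  simp only [e1]
  rw [intervalIntegrable_iff_integrableOn_Ioc_of_le hmm, intervalIntegral.integral_of_le hmm]
  refine ⟨hl, ?_⟩
  rw [hs]
  have hgD : Integrable (fun t => g t * D t) :=
    hD.bdd_mul (c := M) hg.aestronglyMeasurable (Eventually.of_forall hM)
  simp only [sub_mul]
  rw [integral_sub (hD.const_mul M) hgD, integral_const_mul, hD0]
  ring

lemma lowerset_integral' (D : ℝ → ℝ) (A : Set ℝ)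
    (hA : IsLowerSet A) (hne : A.Nonempty) (hb : BddAbove A) :
    ∃ x, Iio x ⊆ A ∧ A ⊆ Iic x ∧ ∫ t in A, D t = ∫ t in Iic x, D t := by
  have h1 : Iio (sSup A) ⊆ A := by
    intro t ht
    obtain ⟨a, ha, hta⟩ := exists_lt_of_lt_csSup hne ht
    exact hA hta.le ha
  have h2 : A ⊆ Iic (sSup A) := fun t ht => le_csSup hb ht
  refine ⟨sSup A, h1, h2, ?_⟩
  apply setIntegral_congr_set
  refine (LE.le.eventuallyLE h2).antisymm ?_
  exact Iio_ae_eq_Iic.symm.le.trans (LE.le.eventuallyLE h1)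

lemma lowerset_integral (D : ℝ → ℝ) (hD0 : ∫ t, D t = 0) (A : Set ℝ)
    (hA : IsLowerSet A) :
    ∫ t in A, D t = 0 ∨ ∃ x, Iio x ⊆ A ∧ A ⊆ Iic x ∧ ∫ t in A, D t = ∫ t in Iic x, D t := by
  rcases A.eq_empty_or_nonempty with rfl | hne
  · left; simp
  by_cases hb : BddAbove A
  · right
    exact lowerset_integral' D A hA hne hb
  · left
    have : A = univ := by
      ext t
      simp only [mem_univ, iff_true]
      rw [not_bddAbove_iff] at hb
      obtain ⟨a, ha, hta⟩ := hb t
      exact hA hta.le ha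
    rw [this]; simpa using hD0

lemma convex_deriv (v : ℝ → ℝ) (hv : ConvexOn ℝ univ v) (M : ℝ)
    (hL : ∀ x y, |v x - v y| ≤ M * |x - y|) :
    ∃ g : ℝ → ℝ, Monotone g ∧ (∀ t, |g t| ≤ M) ∧ ∀ a b, ∫ t in a..b, g t = v b - v a := by
  let g : ℝ → ℝ := fun t => derivWithin v (Ioi t) t
  have hint : ∀ t : ℝ, t ∈ interior (univ : Set ℝ) := by simp
  have hmono : Monotone g := by
    have := hv.monotoneOn_rightDeriv
    simp only [interior_univ] at this
    exact monotoneOn_univ.1 this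
  have hd : ∀ t, HasDerivWithinAt v (g t) (Ioi t) t := fun t =>
    hv.hasDerivWithinAt_rightDeriv_of_mem_interior (hint t)
  have hsl : ∀ t y, t < y → |slope v t y| ≤ M := by
    intro t y hy
    rw [slope_def_field, abs_div, div_le_iff₀ (abs_pos.2 (by linarith))]
    exact hL y t
  have hbd : ∀ t, |g t| ≤ M := by
    intro t
    rw [abs_le]
    constructor
    · have := hv.rightDeriv_eq_sInf_slope_of_mem_interior (hint t)
      show -M ≤ derivWithin v (Ioi t) t
      rw [this]
      apply le_csInf
      · exact ⟨_, mem_image_of_mem _ (show (t+1) ∈ _ by simp)⟩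
      · rintro _ ⟨y, hy, rfl⟩
        simp at hy
        exact (abs_le.1 (hsl t y hy)).1
    · have := hv.rightDeriv_le_slope_of_mem_interior (hint t) (mem_univ (t+1)) (by linarith)
      exact this.trans (abs_le.1 (hsl t (t+1) (by linarith))).2
  refine ⟨g, hmono, hbd, ?_⟩
  intro a b
  apply intervalIntegral.integral_eq_sub_of_hasDeriv_right
  · exact (hv.continuousOn isOpen_univ).mono (subset_univ _)
  · intro t _; exact hd t
  · exact hmono.intervalIntegrable

lemma mono_slopes (v g : ℝ → ℝ) (hg : Monotone g) (hv : ∀ a b, ∫ t in a..b, g t = v b - v a)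
    (a b : ℝ) (hab : a ≤ b) : g a * (b - a) ≤ v b - v a ∧ v b - v a ≤ g b * (b - a) := by
  rw [← hv]
  constructor
  · have : ∫ t in a..b, g a ≤ ∫ t in a..b, g t :=
      intervalIntegral.integral_mono_on hab (by simp) hg.intervalIntegrable
        (fun t ht => hg ht.1)
    simpa [mul_comm] using this
  · have : ∫ t in a..b, g t ≤ ∫ t in a..b, g b :=
      intervalIntegral.integral_mono_on hab hg.intervalIntegrable (by simp)
        (fun t ht => hg ht.2)
    simpa [mul_comm] using this

lemma level_support (v g : ℝ → ℝ) (hg : Monotone g) (hv : ∀ a b, ∫ t in a..b, g t = v b - v a)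
    (r x : ℝ) (h1 : Iio x ⊆ {t | g t ≤ r}) (h2 : {t | g t ≤ r} ⊆ Iic x) :
    (∀ s, x < s → r * (s - x) < v s - v x) ∧ (∀ t, t ≤ x → v x - v t ≤ r * (x - t)) := by
  constructor
  · intro s hs
    have hm := (mono_slopes v g hg hv ((x+s)/2) s (by linarith)).1
    have hgm : r < g ((x+s)/2) := by
      by_contra h
      have := h2 (show (x+s)/2 ∈ {t | g t ≤ r} from not_lt.1 h)
      simp at this; linarith
    have h3 : ∫ t in x..((x+s)/2), r ≤ ∫ t in x..((x+s)/2), g t := by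
      apply intervalIntegral.integral_mono_on_of_le_Ioo (by linarith) (by simp) hg.intervalIntegrable
      intro t ht
      by_contra h
      have := h2 (show t ∈ {t | g t ≤ r} from (not_le.1 h).le)
      simp at this; linarith [ht.1]
    rw [hv] at h3
    simp at h3
    have : r * (s - (x+s)/2) < g ((x+s)/2) * (s - (x+s)/2) := by
      apply mul_lt_mul_of_pos_right hgm; linarith
    nlinarith
  · intro t ht
    have h3 : ∫ t in t..x, g t ≤ ∫ t in t..x, r := by
      apply intervalIntegral.integral_mono_on_of_le_Ioo ht hg.intervalIntegrable (by simp)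
      intro t ht
      exact h1 ht.2
    rw [hv] at h3
    simp at h3
    linarith

lemma convex_identity (P Q : Measure ℝ) [IsProbabilityMeasure P] [IsProbabilityMeasure Q]
    (hP : Integrable (fun x : ℝ => x) P) (hQ : Integrable (fun x : ℝ => x) Q)
    (h0 : ∫ t, ((P (Iic t)).toReal - (Q (Iic t)).toReal) = 0)
    (v : ℝ → ℝ) (hv : ConvexOn ℝ univ v) (M : ℝ)
    (hL : ∀ x y, |v x - v y| ≤ M * |x - y|) :
    Integrable v P ∧ Integrable v Q ∧ 0 ≤ M ∧
    ∃ g : ℝ → ℝ, Monotone g ∧ (∀ t, |g t| ≤ M) ∧ (∀ a b, ∫ t in a..b, g t = v b - v a) ∧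
    IntervalIntegrable (fun r => ∫ t in {t | g t ≤ r}, ((P (Iic t)).toReal - (Q (Iic t)).toReal))
      volume (-M) M ∧
    ∫ y, v y ∂Q - ∫ y, v y ∂P =
      - ∫ r in (-M)..M, ∫ t in {t | g t ≤ r}, ((P (Iic t)).toReal - (Q (Iic t)).toReal) := by
  obtain ⟨g, hg, hgM, hgv⟩ := convex_deriv v hv M hL
  obtain ⟨a1, a2, a3⟩ := expect_diff P Q hP hQ g hg.measurable M hgM v (by
    intro y; rw [hgv]; ring)
  obtain ⟨b1, b2⟩ := layer_cake _ (cdf_diff_integrable P Q hP hQ) h0 g hg.measurable M hgM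
  exact ⟨a1, a2, (abs_nonneg _).trans (hgM 0), g, hg, hgM, hgv, b1, by rw [a3, b2]⟩

lemma level_lower (g : ℝ → ℝ) (hg : Monotone g) (r : ℝ) : IsLowerSet {t | g t ≤ r} :=
  fun _ _ hab hb => (hg hab).trans hb

/-- Convex order. -/
lemma convex_order (P Q : Measure ℝ) [IsProbabilityMeasure P] [IsProbabilityMeasure Q]
    (hP : Integrable (fun x : ℝ => x) P) (hQ : Integrable (fun x : ℝ => x) Q)
    (h0 : ∫ t, ((P (Iic t)).toReal - (Q (Iic t)).toReal) = 0)
    (hH : ∀ x, ∫ t in Iic x, ((P (Iic t)).toReal - (Q (Iic t)).toReal) ≤ 0)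
    (v : ℝ → ℝ) (hv : ConvexOn ℝ univ v) (M : ℝ)
    (hL : ∀ x y, |v x - v y| ≤ M * |x - y|) :
    Integrable v P ∧ Integrable v Q ∧ ∫ y, v y ∂P ≤ ∫ y, v y ∂Q := by
  obtain ⟨a1, a2, hM, g, hg, hgM, hgv, b1, b2⟩ := convex_identity P Q hP hQ h0 v hv M hL
  refine ⟨a1, a2, ?_⟩
  have : ∫ r in (-M)..M, ∫ t in {t | g t ≤ r}, ((P (Iic t)).toReal - (Q (Iic t)).toReal) ≤ 0 := by
    rw [intervalIntegral.integral_of_le (by linarith)]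
    apply integral_nonpos
    intro r
    rcases lowerset_integral _ h0 _ (level_lower g hg r) with h | ⟨x, -, -, h⟩
    · exact h.le
    · exact h.le.trans (hH x)
  linarith

lemma convex_order_eq (P Q : Measure ℝ) [IsProbabilityMeasure P] [IsProbabilityMeasure Q]
    (hP : Integrable (fun x : ℝ => x) P) (hQ : Integrable (fun x : ℝ => x) Q)
    (h0 : ∫ t, ((P (Iic t)).toReal - (Q (Iic t)).toReal) = 0)
    (v : ℝ → ℝ) (hv : ConvexOn ℝ univ v) (M : ℝ)
    (hL : ∀ x y, |v x - v y| ≤ M * |x - y|)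
    (hH : ∀ x r, |r| < M → (∀ s, x < s → r * (s - x) < v s - v x) →
      (∀ t, t ≤ x → v x - v t ≤ r * (x - t)) →
      ∫ t in Iic x, ((P (Iic t)).toReal - (Q (Iic t)).toReal) = 0) :
    Integrable v P ∧ Integrable v Q ∧ ∫ y, v y ∂P = ∫ y, v y ∂Q := by
  obtain ⟨a1, a2, hM, g, hg, hgM, hgv, b1, b2⟩ := convex_identity P Q hP hQ h0 v hv M hL
  refine ⟨a1, a2, ?_⟩
  have : ∫ r in (-M)..M, ∫ t in {t | g t ≤ r}, ((P (Iic t)).toReal - (Q (Iic t)).toReal) = 0 := by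
    rw [intervalIntegral.integral_of_le (by linarith), integral_Ioc_eq_integral_Ioo]
    apply setIntegral_eq_zero_of_forall_eq_zero
    intro r hr
    rcases lowerset_integral _ h0 _ (level_lower g hg r) with h | ⟨x, h1, h2, h⟩
    · exact h
    · rw [h]
      obtain ⟨c1, c2⟩ := level_support v g hg hgv r x h1 h2
      exact hH x r (abs_lt.2 hr) c1 c2
  linarith

lemma convex_order_strict (P Q : Measure ℝ) [IsProbabilityMeasure P] [IsProbabilityMeasure Q]
    (hP : Integrable (fun x : ℝ => x) P) (hQ : Integrable (fun x : ℝ => x) Q)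
    (h0 : ∫ t, ((P (Iic t)).toReal - (Q (Iic t)).toReal) = 0)
    (hH : ∀ x, ∫ t in Iic x, ((P (Iic t)).toReal - (Q (Iic t)).toReal) ≤ 0)
    (v : ℝ → ℝ) (hv : ConvexOn ℝ univ v) (M : ℝ)
    (hL : ∀ x y, |v x - v y| ≤ M * |x - y|) (x δ ε : ℝ) (hδ : 0 < δ)
    (hx : ∀ y ∈ Icc (x - δ) (x + δ),
      ∫ t in Iic y, ((P (Iic t)).toReal - (Q (Iic t)).toReal) ≤ -ε) 
    (hvx : 2 * v x ≤ v (x - δ) + v (x + δ)) :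
    Integrable v P ∧ Integrable v Q ∧
    ∫ y, v y ∂P + ε * ((v (x - δ) + v (x + δ) - 2 * v x) / δ) ≤ ∫ y, v y ∂Q := by
  obtain ⟨a1, a2, hM, g, hg, hgM, hgv, b1, b2⟩ := convex_identity P Q hP hQ h0 v hv M hL
  refine ⟨a1, a2, ?_⟩
  set p := (v (x + δ) - v x) / δ with hp
  set q := (v x - v (x - δ)) / δ with hq
  have hpq : q ≤ p := by
    exact (div_le_div_iff_of_pos_right hδ).2 (by linarith)
  have s1 := (mono_slopes v g hg hgv (x - δ) x (by linarith)).1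
  have s2 := (mono_slopes v g hg hgv x (x + δ) (by linarith)).2
  have e1 : g (x - δ) ≤ q := by rw [hq, le_div_iff₀ hδ]; linarith
  have e2 : p ≤ g (x + δ) := by rw [hp, div_le_iff₀ hδ]; linarith
  have hqM : -M ≤ q := (abs_le.1 (hgM _)).1.trans e1
  have hpM : p ≤ M := e2.trans (abs_le.1 (hgM _)).2
  have key : ∀ r, ∫ t in {t | g t ≤ r}, ((P (Iic t)).toReal - (Q (Iic t)).toReal)
      ≤ (Ioo q p).indicator (fun _ => -ε) r := by
    intro r
    by_cases hr : r ∈ Ioo q p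
    · rw [indicator_of_mem hr]
      have m1 : x - δ ∈ {t | g t ≤ r} := e1.trans hr.1.le
      have m2 : x + δ ∉ {t | g t ≤ r} := by
        intro h; exact absurd (lt_of_lt_of_le hr.2 e2) (not_lt.2 h)
      have hlow := level_lower g hg r
      have hbdd : BddAbove {t | g t ≤ r} := ⟨x + δ, fun t ht => by
        by_contra h; exact m2 (hlow (not_le.1 h).le ht)⟩
      rcases lowerset_integral' _ _ hlow ⟨_, m1⟩ hbdd with ⟨y, h1, h2, h⟩
      rw [h]
      apply hx
      refine ⟨h2 m1, ?_⟩
      by_contra h'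
      exact m2 (h1 (not_le.1 h'))
    · rw [indicator_of_notMem hr]
      rcases lowerset_integral _ h0 _ (level_lower g hg r) with h | ⟨x, -, -, h⟩
      · exact h.le
      · exact h.le.trans (hH x)
  have hint : ∫ r in (-M)..M, ∫ t in {t | g t ≤ r}, ((P (Iic t)).toReal - (Q (Iic t)).toReal)
      ≤ -ε * (p - q) := by
    have : ∫ r in (-M)..M, (Ioo q p).indicator (fun _ => -ε) r = -ε * (p - q) := by
      rw [intervalIntegral.integral_of_le (by linarith), integral_Ioc_eq_integral_Ioo,
        setIntegral_indicator measurableSet_Ioo]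
      have : Ioo (-M) M ∩ Ioo q p = Ioo q p := by
        apply inter_eq_right.2; exact Ioo_subset_Ioo hqM hpM
      rw [this]; simp [hpq]; ring
    rw [← this]
    apply intervalIntegral.integral_mono_on (by linarith) b1 _ (fun r _ => key r)
    refine (intervalIntegrable_const (c := |ε|)).mono_fun'
      (measurable_const.indicator measurableSet_Ioo).aestronglyMeasurable ?_
    exact Eventually.of_forall fun r => by
      simp only [indicator]; split_ifs <;> simp
  have : (v (x - δ) + v (x + δ) - 2 * v x) / δ = p - q := by
    rw [hp, hq]; ring
  rw [this]
  linarith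

/-- Lipschitz regularisation (infimal convolution) of `C - φ`. -/
noncomputable def infc (φ : ℝ → EReal) (C M y : ℝ) : ℝ :=
  ⨅ z : {z : ℝ // φ z ≠ ⊥}, (C - (φ z).toReal + M * |y - z|)

lemma coe_toReal_phi {φ : ℝ → EReal} (hφ : IsPhi φ) {z : ℝ} (hz : φ z ≠ ⊥) :
    (((φ z).toReal : ℝ) : EReal) = φ z := EReal.coe_toReal (hφ.2.1 z) hz

lemma toReal_le_of {φ : ℝ → EReal} (hφ : IsPhi φ) {C : ℝ} {z : ℝ} (hz : φ z ≠ ⊥)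
    (h : φ z ≤ (C : EReal)) : (φ z).toReal ≤ C := by
  rw [← coe_toReal_phi hφ hz] at h
  exact_mod_cast h

lemma phi_concave_real {φ : ℝ → EReal} (hφ : IsPhi φ) {x y a b : ℝ} (hx : φ x ≠ ⊥) (hy : φ y ≠ ⊥)
    (ha : 0 < a) (hb : 0 < b) (hab : a + b = 1) :
    φ (a * x + b * y) ≠ ⊥ ∧ a * (φ x).toReal + b * (φ y).toReal ≤ (φ (a * x + b * y)).toReal := by
  have h := hφ.2.2.1 x y a b ha hb hab
  rw [← coe_toReal_phi hφ hx, ← coe_toReal_phi hφ hy] at h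
  simp only [smul_eq_mul] at h
  have h' : ((a * (φ x).toReal + b * (φ y).toReal : ℝ) : EReal) ≤ φ (a * x + b * y) := by
    exact_mod_cast h
  have hne : φ (a * x + b * y) ≠ ⊥ := by
    intro h0; rw [h0] at h'; exact absurd (le_bot_iff.1 h') (EReal.coe_ne_bot _)
  refine ⟨hne, ?_⟩
  rw [← coe_toReal_phi hφ hne] at h'
  exact_mod_cast h'

lemma infc_bdd {φ : ℝ → EReal} (hφ : IsPhi φ) {C M : ℝ} (hC : ∀ x, φ x ≤ (C : EReal))
    (hM : 0 ≤ M) (y : ℝ) :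
    BddBelow (range fun z : {z : ℝ // φ z ≠ ⊥} => (C - (φ z).toReal + M * |y - z|)) := by
  refine ⟨0, ?_⟩
  rintro _ ⟨z, rfl⟩
  have := toReal_le_of hφ z.2 (hC z)
  have := mul_nonneg hM (abs_nonneg (y - z))
  simp only; linarith

lemma infc_le {φ : ℝ → EReal} (hφ : IsPhi φ) {C M : ℝ} (hC : ∀ x, φ x ≤ (C : EReal))
    (hM : 0 ≤ M) (y z : ℝ) (hz : φ z ≠ ⊥) :
    infc φ C M y ≤ C - (φ z).toReal + M * |y - z| :=
  ciInf_le (infc_bdd hφ hC hM y) ⟨z, hz⟩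

lemma infc_nonneg {φ : ℝ → EReal} (hφ : IsPhi φ) {C M : ℝ} (hC : ∀ x, φ x ≤ (C : EReal))
    (hM : 0 ≤ M) (y : ℝ) : 0 ≤ infc φ C M y := by
  apply Real.iInf_nonneg
  intro z
  have := toReal_le_of hφ z.2 (hC z)
  have := mul_nonneg hM (abs_nonneg (y - z))
  linarith

lemma infc_approx {φ : ℝ → EReal} {C M : ℝ} 
    (hne : ∃ z, φ z ≠ ⊥) (y : ℝ) {w : ℝ} (hw : infc φ C M y < w) :
    ∃ z, φ z ≠ ⊥ ∧ C - (φ z).toReal + M * |y - z| < w := by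
  have : Nonempty {z : ℝ // φ z ≠ ⊥} := let ⟨z, hz⟩ := hne; ⟨⟨z, hz⟩⟩
  obtain ⟨z, hz⟩ := exists_lt_of_ciInf_lt hw
  exact ⟨z, z.2, hz⟩

lemma infc_lip {φ : ℝ → EReal} (hφ : IsPhi φ) {C M : ℝ} (hC : ∀ x, φ x ≤ (C : EReal))
    (hM : 0 ≤ M) (hne : ∃ z, φ z ≠ ⊥) (x y : ℝ) :
    |infc φ C M x - infc φ C M y| ≤ M * |x - y| := by
  have key : ∀ x y, infc φ C M x ≤ infc φ C M y + M * |x - y| := by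
    intro x y
    refine le_of_forall_pos_lt_add fun ε hε => ?_
    obtain ⟨z, hz, h⟩ := infc_approx (φ := φ) (C := C) (M := M) hne y
      (w := infc φ C M y + ε) (by linarith)
    have h1 := infc_le hφ hC hM x z hz
    have h2 : M * |x - z| ≤ M * |x - y| + M * |y - z| := by
      rw [← mul_add]; exact mul_le_mul_of_nonneg_left (abs_sub_le x y z) hM
    linarith
  rw [abs_le]
  have h1 := key x y
  have h2 := key y x
  rw [abs_sub_comm y x] at h2
  constructor <;> linarith

lemma infc_convex {φ : ℝ → EReal} (hφ : IsPhi φ) {C M : ℝ} (hC : ∀ x, φ x ≤ (C : EReal))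
    (hM : 0 ≤ M) (hne : ∃ z, φ z ≠ ⊥) : ConvexOn ℝ univ (infc φ C M) := by
  refine convexOn_iff_forall_pos.2 ⟨convex_univ, ?_⟩
  intro x _ y _ a b ha hb hab
  simp only [smul_eq_mul]
  refine le_of_forall_pos_lt_add fun ε hε => ?_
  obtain ⟨z, hz, h⟩ := infc_approx (φ := φ) (C := C) (M := M) hne x
      (w := infc φ C M x + ε) (by linarith)
  obtain ⟨w, hw, h'⟩ := infc_approx (φ := φ) (C := C) (M := M) hne y
      (w := infc φ C M y + ε) (by linarith)
  obtain ⟨h1, h2⟩ := phi_concave_real hφ hz hw ha hb hab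
  have h3 := infc_le hφ hC hM (a * x + b * y) _ h1
  have h4 : |a * x + b * y - (a * z + b * w)| ≤ a * |x - z| + b * |y - w| := by
    have : a * x + b * y - (a * z + b * w) = a * (x - z) + b * (y - w) := by ring
    rw [this]
    refine (abs_add_le _ _).trans ?_
    rw [abs_mul, abs_mul, abs_of_pos ha, abs_of_pos hb]
  have h5 := mul_le_mul_of_nonneg_left h4 hM
  have h6 := mul_lt_mul_of_pos_left h ha
  have h7 := mul_lt_mul_of_pos_left h' hb
  have h8 : a * C + b * C = C := by rw [← add_mul, hab, one_mul]
  have h9 : a * ε + b * ε = ε := by rw [← add_mul, hab, one_mul]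
  nlinarith

lemma infc_mono {φ : ℝ → EReal} (hφ : IsPhi φ) {C M M' : ℝ} (hC : ∀ x, φ x ≤ (C : EReal))
    (hM : 0 ≤ M) (hMM : M ≤ M') (hne : ∃ z, φ z ≠ ⊥) (y : ℝ) : infc φ C M y ≤ infc φ C M' y := by
  refine le_of_forall_pos_lt_add fun ε hε => ?_
  obtain ⟨z, hz, h⟩ := infc_approx (φ := φ) (C := C) (M := M') hne y
      (w := infc φ C M' y + ε) (by linarith)
  have h1 := infc_le hφ hC hM y z hz
  have := mul_le_mul_of_nonneg_right hMM (abs_nonneg (y - z))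
  linarith

/-- `k = C - φ` as a `ℝ≥0∞`-valued function. -/
noncomputable def kf (φ : ℝ → EReal) (C : ℝ) (x : ℝ) : ℝ≥0∞ := ((C : EReal) - φ x).toENNReal

lemma kf_bot {φ : ℝ → EReal} {C x : ℝ} (h : φ x = ⊥) : kf φ C x = ⊤ := by
  simp [kf, h]

lemma kf_real {φ : ℝ → EReal} (hφ : IsPhi φ) {C x : ℝ} (h : φ x ≠ ⊥) :
    kf φ C x = ENNReal.ofReal (C - (φ x).toReal) := by
  unfold kf
  conv_lhs => rw [← coe_toReal_phi hφ h, ← EReal.coe_sub]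
  exact EReal.real_coe_toENNReal _

lemma infc_eventually_gt {φ : ℝ → EReal} (hφ : IsPhi φ) {C : ℝ} (hC : ∀ x, φ x ≤ (C : EReal))
    (hne : ∃ z, φ z ≠ ⊥) (y w : ℝ) (hw : φ y < ((C - w : ℝ) : EReal)) :
    ∃ N : ℕ, ∀ n : ℕ, N ≤ n → w ≤ infc φ C n y := by
  have hu := hφ.1 y _ hw
  obtain ⟨δ, hδ, hball⟩ := Metric.eventually_nhds_iff.1 hu
  obtain ⟨N, hN⟩ := exists_nat_gt (w / δ)
  refine ⟨N, fun n hn => ?_⟩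
  by_contra hlt
  obtain ⟨z, hz, h⟩ := infc_approx (φ := φ) hne y (not_le.1 hlt)
  have hnn : (N : ℝ) ≤ n := by exact_mod_cast hn
  by_cases hd : dist z y < δ
  · have h1 : φ z < _ := hball hd
    rw [← coe_toReal_phi hφ hz] at h1
    have h1 : (φ z).toReal < C - w := by exact_mod_cast h1
    have := mul_nonneg (Nat.cast_nonneg (α := ℝ) n) (abs_nonneg (y - z))
    linarith
  · have h2 : δ ≤ |y - z| := by rw [abs_sub_comm]; exact not_lt.1 hd
    have h3 := toReal_le_of hφ hz (hC z)
    rw [div_lt_iff₀ hδ] at hN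
    have h4 : (N : ℝ) * δ ≤ n * |y - z| := mul_le_mul hnn h2 hδ.le (Nat.cast_nonneg n)
    linarith

lemma infc_iSup {φ : ℝ → EReal} (hφ : IsPhi φ) {C : ℝ} (hC : ∀ x, φ x ≤ (C : EReal))
    (hne : ∃ z, φ z ≠ ⊥) (y : ℝ) :
    ⨆ n : ℕ, ENNReal.ofReal (infc φ C n y) = kf φ C y := by
  apply le_antisymm
  · apply iSup_le
    intro n
    by_cases h : φ y = ⊥
    · rw [kf_bot h]; exact le_top
    · rw [kf_real hφ h]
      apply ENNReal.ofReal_le_ofReal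
      have := infc_le hφ hC (Nat.cast_nonneg n) y y h
      simpa using this
  · apply le_of_forall_lt
    intro c hc
    have hc' : c ≠ ⊤ := hc.ne_top
    obtain ⟨d, hcd, hdk⟩ := exists_between hc
    have hd' : d ≠ ⊤ := hdk.ne_top
    have : φ y < ((C - d.toReal : ℝ) : EReal) := by
      by_cases h : φ y = ⊥
      · rw [h]; exact EReal.bot_lt_coe _
      · rw [kf_real hφ h] at hdk
        rw [← coe_toReal_phi hφ h]
        rw [ENNReal.lt_ofReal_iff_toReal_lt hd'] at hdk
        have : (φ y).toReal < C - d.toReal := by linarith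
        exact_mod_cast this
    obtain ⟨N, hN⟩ := infc_eventually_gt hφ hC hne y _ this
    have := hN N le_rfl
    refine lt_of_lt_of_le hcd (le_trans ?_ (le_iSup _ N))
    rw [← ENNReal.ofReal_toReal hd']
    exact ENNReal.ofReal_le_ofReal this

lemma infc_contact {φ : ℝ → EReal} (hφ : IsPhi φ) {C M : ℝ} (hC : ∀ x, φ x ≤ (C : EReal))
    (hM : 0 ≤ M) (hne : ∃ z, φ z ≠ ⊥) (x r : ℝ) (hr : |r| < M)
    (h : ∀ s, r * (s - x) ≤ infc φ C M s - infc φ C M x) :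
    φ x ≠ ⊥ ∧ infc φ C M x = C - (φ x).toReal := by
  have key : ((C - infc φ C M x : ℝ) : EReal) ≤ φ x := by
    by_contra hlt
    rw [not_le] at hlt
    obtain ⟨c, hc1, hc2⟩ := EReal.lt_iff_exists_real_btwn.1 hlt
    have hc2 : c < C - infc φ C M x := by exact_mod_cast hc2
    have hu := hφ.1 x _ hc1
    obtain ⟨δ, hδ, hball⟩ := Metric.eventually_nhds_iff.1 hu
    have hMr : 0 < M - |r| := by linarith
    have he : 0 < min (C - infc φ C M x - c) ((M - |r|) * δ) :=
      lt_min (by linarith) (by positivity)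
    obtain ⟨z, hz, hzz⟩ := infc_approx (φ := φ) (C := C) (M := M) hne x
      (w := infc φ C M x + min (C - infc φ C M x - c) ((M - |r|) * δ)) (by linarith)
    have h1 := infc_le hφ hC hM z z hz
    simp only [sub_self, abs_zero, mul_zero, add_zero] at h1
    have h2 := h z
    have h3 : -(|r| * |x - z|) ≤ r * (z - x) := by
      rw [← abs_mul]
      have := neg_abs_le (r * (x - z))
      have e : |r * (x - z)| = |r * (z - x)| := by rw [abs_mul, abs_mul, abs_sub_comm]
      rw [e]; exact neg_abs_le _
    have hm1 := min_le_left (C - infc φ C M x - c) ((M - |r|) * δ)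
    have hm2 := min_le_right (C - infc φ C M x - c) ((M - |r|) * δ)
    have h4 : (M - |r|) * |x - z| < (M - |r|) * δ := by linarith
    have h5 : |x - z| < δ := lt_of_mul_lt_mul_left h4 hMr.le
    have h6 : φ z < _ := hball (show dist z x < δ by rw [Real.dist_eq, abs_sub_comm]; exact h5)
    rw [← coe_toReal_phi hφ hz] at h6
    have h6 : (φ z).toReal < c := by exact_mod_cast h6
    have := mul_nonneg hM (abs_nonneg (x - z))
    linarith
  have hb : φ x ≠ ⊥ := by
    intro h0; rw [h0] at key; exact absurd (le_bot_iff.1 key) (EReal.coe_ne_bot _)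
  refine ⟨hb, le_antisymm ?_ ?_⟩
  · have := infc_le hφ hC hM x x hb
    simpa using this
  · rw [← coe_toReal_phi hφ hb] at key
    have : C - infc φ C M x ≤ (φ x).toReal := by exact_mod_cast key
    linarith

lemma infc_contact_mem_S {φ : ℝ → EReal} (hφ : IsPhi φ) {C M : ℝ} (hC : ∀ x, φ x ≤ (C : EReal))
    (hM : 0 ≤ M) (hne : ∃ z, φ z ≠ ⊥) (x r : ℝ) (hr : |r| < M)
    (h1 : ∀ s, x < s → r * (s - x) < infc φ C M s - infc φ C M x)
    (h2 : ∀ t, t ≤ x → infc φ C M x - infc φ C M t ≤ r * (x - t)) :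
    φ x ≠ ⊥ ∧ ∀ δ : ℝ, 0 < δ → φ (x - δ) + φ (x + δ) < φ x + φ x := by
  obtain ⟨hb, he⟩ := infc_contact hφ hC hM hne x r hr (by
    intro s
    rcases lt_or_ge x s with h | h
    · exact (h1 s h).le
    · have := h2 s h; linarith)
  refine ⟨hb, fun δ hδ => ?_⟩
  have hxx : φ x + φ x = (((φ x).toReal + (φ x).toReal : ℝ) : EReal) := by
    rw [EReal.coe_add, coe_toReal_phi hφ hb]
  rw [hxx]
  by_cases ha : φ (x - δ) = ⊥
  · rw [ha, EReal.bot_add]; exact EReal.bot_lt_coe _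
  by_cases hc : φ (x + δ) = ⊥
  · rw [hc, EReal.add_bot]; exact EReal.bot_lt_coe _
  rw [← coe_toReal_phi hφ ha, ← coe_toReal_phi hφ hc, ← EReal.coe_add, EReal.coe_lt_coe_iff]
  have i1 := infc_le hφ hC hM (x - δ) (x - δ) ha
  have i2 := infc_le hφ hC hM (x + δ) (x + δ) hc
  simp only [sub_self, abs_zero, mul_zero, add_zero] at i1 i2
  have j1 := h1 (x + δ) (by linarith)
  have j2 := h2 (x - δ) (by linarith)
  nlinarith

lemma lint_infc_iSup {φ : ℝ → EReal} (hφ : IsPhi φ) {C : ℝ} (hC : ∀ x, φ x ≤ (C : EReal))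
    (hne : ∃ z, φ z ≠ ⊥) (μ : Measure ℝ) :
    ∫⁻ x, kf φ C x ∂μ = ⨆ n : ℕ, ∫⁻ x, ENNReal.ofReal (infc φ C n x) ∂μ := by
  rw [← lintegral_iSup]
  · simp only [infc_iSup hφ hC hne]
  · intro n
    have : Continuous (infc φ C n) := by
      have := (infc_convex hφ hC (Nat.cast_nonneg n) hne).continuousOn isOpen_univ
      exact continuousOn_univ.1 this
    exact this.measurable.ennreal_ofReal
  · intro m n hmn x
    apply ENNReal.ofReal_le_ofReal
    exact infc_mono hφ hC (Nat.cast_nonneg m) (by exact_mod_cast hmn) hne x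

lemma lint_infc {φ : ℝ → EReal} (hφ : IsPhi φ) {C M : ℝ} (hC : ∀ x, φ x ≤ (C : EReal))
    (hM : 0 ≤ M) (μ : Measure ℝ) (h : Integrable (infc φ C M) μ) :
    ∫⁻ x, ENNReal.ofReal (infc φ C M x) ∂μ = ENNReal.ofReal (∫ x, infc φ C M x ∂μ) :=
  (ofReal_integral_eq_lintegral_ofReal h
    (Eventually.of_forall fun x => infc_nonneg hφ hC hM x)).symm

/-- Convex order for `C - ψ`. -/
lemma kf_order (P Q : Measure ℝ) [IsProbabilityMeasure P] [IsProbabilityMeasure Q]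
    (hP : Integrable (fun x : ℝ => x) P) (hQ : Integrable (fun x : ℝ => x) Q)
    (h0 : ∫ t, ((P (Iic t)).toReal - (Q (Iic t)).toReal) = 0)
    (hH : ∀ x, ∫ t in Iic x, ((P (Iic t)).toReal - (Q (Iic t)).toReal) ≤ 0)
    {φ : ℝ → EReal} (hφ : IsPhi φ) {C : ℝ} (hC : ∀ x, φ x ≤ (C : EReal))
    (hne : ∃ z, φ z ≠ ⊥) : ∫⁻ x, kf φ C x ∂P ≤ ∫⁻ x, kf φ C x ∂Q := by
  rw [lint_infc_iSup hφ hC hne, lint_infc_iSup hφ hC hne]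
  apply iSup_mono
  intro n
  have hn : (0:ℝ) ≤ n := Nat.cast_nonneg n
  obtain ⟨a, b, c⟩ := convex_order P Q hP hQ h0 hH _ (infc_convex hφ hC hn hne) _
    (infc_lip hφ hC hn hne)
  rw [lint_infc hφ hC hn _ a, lint_infc hφ hC hn _ b]
  exact ENNReal.ofReal_le_ofReal c

lemma kf_order_eq (P Q : Measure ℝ) [IsProbabilityMeasure P] [IsProbabilityMeasure Q]
    (hP : Integrable (fun x : ℝ => x) P) (hQ : Integrable (fun x : ℝ => x) Q)
    (h0 : ∫ t, ((P (Iic t)).toReal - (Q (Iic t)).toReal) = 0)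
    {φ : ℝ → EReal} (hφ : IsPhi φ) {C : ℝ} (hC : ∀ x, φ x ≤ (C : EReal))
    (hne : ∃ z, φ z ≠ ⊥)
    (hS : ∀ x, (φ x ≠ ⊥ ∧ ∀ δ : ℝ, 0 < δ → φ (x - δ) + φ (x + δ) < φ x + φ x) →
      ∫ t in Iic x, ((P (Iic t)).toReal - (Q (Iic t)).toReal) = 0) :
    ∫⁻ x, kf φ C x ∂P = ∫⁻ x, kf φ C x ∂Q := by
  rw [lint_infc_iSup hφ hC hne, lint_infc_iSup hφ hC hne]
  congr 1
  ext1 n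
  have hn : (0:ℝ) ≤ n := Nat.cast_nonneg n
  obtain ⟨a, b, c⟩ := convex_order_eq P Q hP hQ h0 _ (infc_convex hφ hC hn hne) _
    (infc_lip hφ hC hn hne) (fun x r hr h1 h2 => hS x
      (infc_contact_mem_S hφ hC hn hne x r hr h1 h2))
  rw [lint_infc hφ hC hn _ a, lint_infc hφ hC hn _ b, c]

lemma kf_order_strict (P Q : Measure ℝ) [IsProbabilityMeasure P] [IsProbabilityMeasure Q]
    (hP : Integrable (fun x : ℝ => x) P) (hQ : Integrable (fun x : ℝ => x) Q)
    (h0 : ∫ t, ((P (Iic t)).toReal - (Q (Iic t)).toReal) = 0)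
    (hH : ∀ x, ∫ t in Iic x, ((P (Iic t)).toReal - (Q (Iic t)).toReal) ≤ 0)
    {φ : ℝ → EReal} (hφ : IsPhi φ) {C : ℝ} (hC : ∀ x, φ x ≤ (C : EReal))
    (hne : ∃ z, φ z ≠ ⊥) (x δ ε : ℝ) (hδ : 0 < δ) (hε : 0 < ε)
    (hx : ∀ y ∈ Icc (x - δ) (x + δ),
      ∫ t in Iic y, ((P (Iic t)).toReal - (Q (Iic t)).toReal) ≤ -ε) 
    (hxb : φ x ≠ ⊥) (hxS : φ (x - δ) + φ (x + δ) < φ x + φ x) :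
    ∃ ε' > 0, ∫⁻ x, kf φ C x ∂P + ENNReal.ofReal ε' ≤ ∫⁻ x, kf φ C x ∂Q := by
  -- find real numbers strictly between
  have hxx : φ x + φ x = (((φ x).toReal + (φ x).toReal : ℝ) : EReal) := by
    rw [EReal.coe_add, coe_toReal_phi hφ hxb]
  rw [hxx] at hxS
  obtain ⟨p, q, hp, hq, hpq⟩ : ∃ p q : ℝ, φ (x - δ) < (p : EReal) ∧ φ (x + δ) < (q : EReal) ∧
      p + q < (φ x).toReal + (φ x).toReal := by
    by_cases ha : φ (x - δ) = ⊥
    · by_cases hc : φ (x + δ) = ⊥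
      · exact ⟨(φ x).toReal - 1, (φ x).toReal, by simp [ha, -EReal.coe_sub], by
          simp [hc], by linarith⟩
      · refine ⟨(φ x).toReal + (φ x).toReal - ((φ (x+δ)).toReal + 1) - 1, (φ (x+δ)).toReal + 1, 
          by rw [ha]; exact EReal.bot_lt_coe _, ?_, by linarith⟩
        conv_lhs => rw [← coe_toReal_phi hφ hc]
        rw [EReal.coe_lt_coe_iff]; linarith
    · by_cases hc : φ (x + δ) = ⊥
      · refine ⟨(φ (x-δ)).toReal + 1, (φ x).toReal + (φ x).toReal - ((φ (x-δ)).toReal + 1) - 1,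
          ?_, by rw [hc]; exact EReal.bot_lt_coe _, by linarith⟩
        conv_lhs => rw [← coe_toReal_phi hφ ha]
        rw [EReal.coe_lt_coe_iff]; linarith
      · rw [← coe_toReal_phi hφ ha, ← coe_toReal_phi hφ hc, ← EReal.coe_add,
          EReal.coe_lt_coe_iff] at hxS
        set A := (φ (x-δ)).toReal
        set B := (φ (x+δ)).toReal
        set X := (φ x).toReal
        refine ⟨A + (X + X - A - B) / 4, B + (X + X - A - B) / 4, ?_, ?_, by linarith⟩
        · conv_lhs => rw [← coe_toReal_phi hφ ha]
          rw [EReal.coe_lt_coe_iff]; linarith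
        · conv_lhs => rw [← coe_toReal_phi hφ hc]
          rw [EReal.coe_lt_coe_iff]; linarith
  set η := (φ x).toReal + (φ x).toReal - (p + q) with hη
  have hηp : 0 < η := by linarith
  obtain ⟨N1, hN1⟩ := infc_eventually_gt hφ hC hne (x - δ) (C - p) (by simpa using hp)
  obtain ⟨N2, hN2⟩ := infc_eventually_gt hφ hC hne (x + δ) (C - q) (by simpa using hq)
  refine ⟨ε * (η / δ), by positivity, ?_⟩
  rw [lint_infc_iSup hφ hC hne P, ENNReal.iSup_add]
  apply iSup_le
  intro m
  set n := max m (max N1 N2) with hnn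
  have hn : (0:ℝ) ≤ n := Nat.cast_nonneg n
  have hmn : ∫⁻ x, ENNReal.ofReal (infc φ C m x) ∂P ≤ ∫⁻ x, ENNReal.ofReal (infc φ C n x) ∂P := by
    apply lintegral_mono
    intro y
    apply ENNReal.ofReal_le_ofReal
    exact infc_mono hφ hC (Nat.cast_nonneg m) (by exact_mod_cast le_max_left _ _) hne y
  have g1 := hN1 n ((le_max_left _ _).trans (le_max_right _ _))
  have g2 := hN2 n ((le_max_right _ _).trans (le_max_right _ _))
  have g3 := infc_le hφ hC hn x x hxb
  simp only [sub_self, abs_zero, mul_zero, add_zero] at g3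
  have g4 : η ≤ infc φ C n (x - δ) + infc φ C n (x + δ) - 2 * infc φ C n x := by linarith
  obtain ⟨a, b, c⟩ := convex_order_strict P Q hP hQ h0 hH _ (infc_convex hφ hC hn hne) _
    (infc_lip hφ hC hn hne) x δ ε hδ hx (by linarith)
  have g5 : ε * (η / δ) ≤
      ε * ((infc φ C n (x - δ) + infc φ C n (x + δ) - 2 * infc φ C n x) / δ) := by
    apply mul_le_mul_of_nonneg_left _ hε.le
    exact (div_le_div_iff_of_pos_right hδ).2 g4
  calc _ ≤ ∫⁻ x, ENNReal.ofReal (infc φ C n x) ∂P + ENNReal.ofReal (ε * (η / δ)) := by gcongr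
    _ = ENNReal.ofReal (∫ x, infc φ C n x ∂P + ε * (η / δ)) := by
        rw [lint_infc hφ hC hn _ a, ENNReal.ofReal_add _ (by positivity)]
        exact integral_nonneg fun y => infc_nonneg hφ hC hn y
    _ ≤ ENNReal.ofReal (∫ x, infc φ C n x ∂Q) := ENNReal.ofReal_le_ofReal (by linarith)
    _ = ∫⁻ x, ENNReal.ofReal (infc φ C n x) ∂Q := (lint_infc hφ hC hn _ b).symm
    _ ≤ _ := by
        rw [lint_infc_iSup hφ hC hne Q]
        exact le_iSup (fun n : ℕ => ∫⁻ x, ENNReal.ofReal (infc φ C n x) ∂Q) n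

lemma phi_bound {φ : ℝ → EReal} (hφ : IsPhi φ) :
    ∃ a b : ℝ, 0 < b ∧ ∀ x, φ x ≤ ((a - b * |x| : ℝ) : EReal) := by
  by_cases hne : ∃ z, φ z ≠ ⊥
  swap
  · push Not at hne
    exact ⟨0, 1, one_pos, fun x => by rw [hne x]; exact bot_le⟩
  obtain ⟨x0, hx0⟩ := hne
  set c0 := (φ x0).toReal with hc0
  have hco := hφ.2.2.2
  have h1 : ∀ᶠ x in comap (fun x : ℝ => ‖x‖) atTop, φ x < ((c0 - 1 : ℝ) : EReal) :=
    hco.eventually (gt_mem_nhds (EReal.bot_lt_coe _))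
  rw [eventually_comap] at h1
  obtain ⟨R0, hR0⟩ := eventually_atTop.1 h1
  set R := max R0 1 with hR
  have hRpos : 0 < R := lt_of_lt_of_le one_pos (le_max_right _ _)
  have hR1 : ∀ x : ℝ, R ≤ |x| → φ x < ((c0 - 1 : ℝ) : EReal) := fun x hx =>
    hR0 |x| ((le_max_left _ _).trans hx) x rfl
  have hx0R : |x0| < R := by
    by_contra h
    have := hR1 x0 (not_lt.1 h)
    rw [← coe_toReal_phi hφ hx0, ← hc0] at this
    have : c0 < c0 - 1 := by exact_mod_cast this
    linarith
  obtain ⟨xm, hxm, hmax⟩ := (hφ.1.upperSemicontinuousOn (Icc (-R) R)).exists_isMaxOn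
    (nonempty_Icc.2 (by linarith)) isCompact_Icc
  set m := (φ xm).toReal with hm
  have hSpos : 0 < R + |x0| := by positivity
  refine ⟨max m c0 + 1, 1 / (R + |x0|), by positivity, fun x => ?_⟩
  by_cases hb : φ x = ⊥
  · rw [hb]; exact bot_le
  rw [← coe_toReal_phi hφ hb]
  rw [EReal.coe_le_coe_iff]
  by_cases hx : |x| ≤ R
  · have h2 : φ x ≤ φ xm := hmax (abs_le.1 hx)
    have h3 : (φ x).toReal ≤ m := EReal.toReal_le_toReal h2 hb (hφ.2.1 xm)
    have h4 : 1 / (R + |x0|) * |x| ≤ 1 := by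
      rw [one_div, inv_mul_le_one₀ hSpos]; linarith [abs_nonneg x0]
    linarith [le_max_left m c0]
  · push Not at hx
    have hTpos : 0 < |x| + |x0| := by linarith [abs_nonneg x0]
    set l := (R + |x0|) / (|x| + |x0|) with hl
    have hl0 : 0 < l := by positivity
    have hl1 : l < 1 := by rw [hl, div_lt_one hTpos]; linarith
    have hlT : l * (|x| + |x0|) = R + |x0| := by rw [hl]; field_simp
    obtain ⟨g1, g2⟩ := phi_concave_real hφ hx0 hb (sub_pos.2 hl1) hl0 (by ring)
    have hy : R ≤ |(1 - l) * x0 + l * x| := by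
      have e1 : |l * x| ≤ |(1 - l) * x0 + l * x| + |(1 - l) * x0| := by
        have := abs_sub ((1 - l) * x0 + l * x) ((1 - l) * x0)
        rwa [add_sub_cancel_left] at this
      rw [abs_mul, abs_mul, abs_of_pos hl0, abs_of_pos (sub_pos.2 hl1)] at e1
      nlinarith
    have h5 := hR1 _ hy
    rw [← coe_toReal_phi hφ g1] at h5
    have h5 : (φ ((1 - l) * x0 + l * x)).toReal < c0 - 1 := by exact_mod_cast h5
    have h6 : l * (φ x).toReal < l * c0 - 1 := by
      rw [← hc0] at g2; nlinarith
    have h7 : (φ x).toReal < c0 - 1 / l := by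
      have : l * (1 / l) = 1 := by field_simp
      by_contra hcon
      have := mul_le_mul_of_nonneg_left (not_lt.1 hcon) hl0.le
      nlinarith
    have h8 : 1 / l = 1 / (R + |x0|) * (|x| + |x0|) := by rw [hl]; field_simp
    have h9 : 0 ≤ 1 / (R + |x0|) * |x0| := by positivity
    rw [h8, mul_add] at h7
    linarith [le_max_right m c0]

lemma isPhi_mk {φ : ℝ → EReal} (husc : UpperSemicontinuous φ)
    (htop : ∀ x, φ x ≠ ⊤)
    (hconc : ∀ x y a b : ℝ, φ x ≠ ⊥ → φ y ≠ ⊥ → 0 < a → 0 < b → a + b = 1 →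
      ((a * (φ x).toReal + b * (φ y).toReal : ℝ) : EReal) ≤ φ (a * x + b * y))
    (A B : ℝ) (hB : 0 < B) (hbd : ∀ x, φ x ≤ ((A - B * |x| : ℝ) : EReal)) : IsPhi φ := by
  refine ⟨husc, htop, ?_, ?_⟩
  · intro x y a b ha hb hab
    by_cases hx : φ x = ⊥
    · rw [hx, EReal.coe_mul_bot_of_pos ha, EReal.bot_add]; exact bot_le
    by_cases hy : φ y = ⊥
    · rw [hy, EReal.coe_mul_bot_of_pos hb, EReal.add_bot]; exact bot_le
    have := hconc x y a b hx hy ha hb hab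
    rw [EReal.coe_add, EReal.coe_mul, EReal.coe_mul, EReal.coe_toReal (htop x) hx,
      EReal.coe_toReal (htop y) hy] at this
    exact this
  · rw [EReal.tendsto_nhds_bot_iff_real]
    intro r
    rw [eventually_comap]
    filter_upwards [eventually_gt_atTop ((A - r) / B)] with s hs x hx
    refine (hbd x).trans_lt ?_
    rw [EReal.coe_lt_coe_iff]
    rw [div_lt_iff₀ hB] at hs
    have : |x| = s := hx
    rw [this]; linarith

lemma isPhi_neg_abs : IsPhi (fun x : ℝ => ((-|x| : ℝ) : EReal)) := by
  refine isPhi_mk ?_ (fun x => EReal.coe_ne_top _) ?_ 0 1 one_pos ?_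
  · exact (continuous_coe_real_ereal.comp continuous_abs.neg).upperSemicontinuous
  · intro x y a b _ _ ha hb hab
    simp only [EReal.toReal_coe]
    rw [EReal.coe_le_coe_iff]
    have := abs_add_le (a * x) (b * y)
    rw [abs_mul, abs_mul, abs_of_pos ha, abs_of_pos hb] at this
    linarith
  · intro x
    rw [EReal.coe_le_coe_iff]; linarith

/-- adding a concave continuous function of slow growth. -/
lemma isPhi_add {φ : ℝ → EReal} (hφ : IsPhi φ) {A B : ℝ} (hbd : ∀ x, φ x ≤ ((A - B * |x| : ℝ) : EReal))
    (w : ℝ → ℝ) (hw : Continuous w) (hwc : ConcaveOn ℝ univ w) (K b' : ℝ) (hb' : b' < B)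
    (hwb : ∀ x, w x ≤ K + b' * |x|) : IsPhi (fun x => φ x + ((w x : ℝ) : EReal)) := by
  refine isPhi_mk ?_ ?_ ?_ (A + K) (B - b') (sub_pos.2 hb') ?_
  · refine UpperSemicontinuous.add' hφ.1
      (continuous_coe_real_ereal.comp hw).upperSemicontinuous ?_
    intro x
    exact EReal.continuousAt_add (Or.inr (EReal.coe_ne_bot _)) (Or.inr (EReal.coe_ne_top _))
  · intro x
    exact EReal.add_ne_top (hφ.2.1 x) (EReal.coe_ne_top _)
  · intro x y a b hx hy ha hb hab
    have hx' : φ x ≠ ⊥ := fun h => hx (by rw [h, EReal.bot_add])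
    have hy' : φ y ≠ ⊥ := fun h => hy (by rw [h, EReal.bot_add])
    obtain ⟨g1, g2⟩ := phi_concave_real hφ hx' hy' ha hb hab
    have e : ∀ z, φ z ≠ ⊥ → (φ z + ((w z : ℝ) : EReal)).toReal = (φ z).toReal + w z := by
      intro z hz
      rw [EReal.toReal_add (hφ.2.1 z) hz (EReal.coe_ne_top _) (EReal.coe_ne_bot _), EReal.toReal_coe]
    rw [e x hx', e y hy']
    conv_rhs => rw [← coe_toReal_phi hφ g1, ← EReal.coe_add]
    rw [EReal.coe_le_coe_iff]
    have := hwc.2 (mem_univ x) (mem_univ y) ha.le hb.le hab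
    simp only [smul_eq_mul] at this
    linarith
  · intro x
    refine (add_le_add (hbd x) (EReal.coe_le_coe_iff.2 (hwb x))).trans ?_
    rw [← EReal.coe_add, EReal.coe_le_coe_iff]
    linarith

lemma isPhi_scale {φ : ℝ → EReal} (hφ : IsPhi φ) (t : ℝ) (ht : t < 1) :
    IsPhi (fun x => φ x + ((t * (-(φ x).toReal) : ℝ) : EReal)) := by
  have hs : 0 < 1 - t := sub_pos.2 ht
  have e : (fun x => φ x + ((t * (-(φ x).toReal) : ℝ) : EReal)) =
      fun x => ((1 - t : ℝ) : EReal) * φ x := by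
    funext x
    by_cases hx : φ x = ⊥
    · rw [hx, EReal.bot_add, EReal.coe_mul_bot_of_pos hs]
    · conv_lhs => rw [← coe_toReal_phi hφ hx, EReal.toReal_coe, ← EReal.coe_add]
      conv_rhs => rw [← coe_toReal_phi hφ hx, ← EReal.coe_mul]
      rw [EReal.coe_eq_coe_iff]; ring
  rw [e]
  obtain ⟨A, B, hB, hbd⟩ := phi_bound hφ
  have hnb : ∀ x, ((1 - t : ℝ) : EReal) * φ x ≠ ⊥ → φ x ≠ ⊥ := fun x hx h =>
    hx (by rw [h, EReal.coe_mul_bot_of_pos hs])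
  have er : ∀ x, φ x ≠ ⊥ → ((1 - t : ℝ) : EReal) * φ x = (((1 - t) * (φ x).toReal : ℝ) : EReal) := by
    intro x hx
    conv_lhs => rw [← coe_toReal_phi hφ hx, ← EReal.coe_mul]
  refine isPhi_mk ?_ ?_ ?_ ((1 - t) * A) ((1 - t) * B) (mul_pos hs hB) ?_
  · have hc : Continuous (fun y : EReal => ((1 - t : ℝ) : EReal) * y) := by
      rw [continuous_iff_continuousAt]
      intro y
      have h0 : ((1 - t : ℝ) : EReal) ≠ 0 := by exact_mod_cast hs.ne'
      exact EReal.Tendsto.const_mul tendsto_id (Or.inl (EReal.coe_ne_bot _)) (Or.inl (EReal.coe_ne_top _))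
    have hm : Monotone (fun y : EReal => ((1 - t : ℝ) : EReal) * y) := fun y z h =>
      mul_le_mul_of_nonneg_left h (by exact_mod_cast hs.le)
    exact hc.comp_upperSemicontinuous hφ.1 hm
  · intro x
    by_cases hx : φ x = ⊥
    · rw [hx, EReal.coe_mul_bot_of_pos hs]; exact bot_ne_top
    · rw [er x hx]; exact EReal.coe_ne_top _
  · intro x y a b hx hy ha hb hab
    obtain ⟨g1, g2⟩ := phi_concave_real hφ (hnb x hx) (hnb y hy) ha hb hab
    rw [er x (hnb x hx), er y (hnb y hy), er _ g1, EReal.toReal_coe, EReal.toReal_coe,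
      EReal.coe_le_coe_iff]
    nlinarith
  · intro x
    by_cases hx : φ x = ⊥
    · rw [hx, EReal.coe_mul_bot_of_pos hs]; exact bot_le
    · rw [er x hx, EReal.coe_le_coe_iff]
      have := toReal_le_of hφ hx (hbd x)
      nlinarith

lemma meas_phi {φ : ℝ → EReal} (hφ : IsPhi φ) : Measurable φ := hφ.1.measurable

lemma meas_exp {φ : ℝ → EReal} (hφ : IsPhi φ) : Measurable (fun x => EReal.exp (φ x)) :=
  EReal.measurable_exp.comp (meas_phi hφ)

lemma meas_kf {φ : ℝ → EReal} (hφ : IsPhi φ) (C : ℝ) : Measurable (kf φ C) := by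
  have : Measurable (fun x => (C : EReal) - φ x) := measurable_const.sub (meas_phi hφ)
  exact EReal.continuous_toENNReal.measurable.comp this

lemma integrable_exp_abs {b : ℝ} (hb : 0 < b) : Integrable (fun x : ℝ => Real.exp (-b * |x|)) := by
  rw [← integrableOn_univ, ← Iic_union_Ioi (a := (0:ℝ))]
  refine IntegrableOn.union ?_ ?_
  · refine (integrableOn_exp_mul_Iic hb 0).congr_fun (fun x hx => ?_) measurableSet_Iic
    simp only [abs_of_nonpos (mem_Iic.1 hx)]; ring_nf
  · refine (integrableOn_exp_mul_Ioi (neg_lt_zero.2 hb) 0).congr_fun (fun x hx => ?_) measurableSet_Ioi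
    simp only [abs_of_pos (mem_Ioi.1 hx)]

lemma exp_lt_top_phi {φ : ℝ → EReal} (hφ : IsPhi φ) (x : ℝ) : EReal.exp (φ x) < ⊤ := by
  rw [EReal.exp_lt_top_iff]; exact lt_top_iff_ne_top.2 (hφ.2.1 x)

lemma expR_real {φ : ℝ → EReal} (hφ : IsPhi φ) {x : ℝ} (h : φ x ≠ ⊥) :
    EReal.expR (φ x) = Real.exp (φ x).toReal := by
  unfold EReal.expR
  conv_lhs => rw [← coe_toReal_phi hφ h, EReal.exp_coe]
  exact ENNReal.toReal_ofReal (Real.exp_pos _).le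

lemma expR_le {φ : ℝ → EReal} (hφ : IsPhi φ) {x r : ℝ} (h : φ x ≤ (r : EReal)) :
    EReal.expR (φ x) ≤ Real.exp r := by
  by_cases hb : φ x = ⊥
  · simp [EReal.expR, hb, (Real.exp_pos r).le]
  · rw [expR_real hφ hb]; exact Real.exp_le_exp.2 (toReal_le_of hφ hb h)

lemma lint_exp_lt_top {φ : ℝ → EReal} (hφ : IsPhi φ) : ∫⁻ x, EReal.exp (φ x) < ⊤ := by
  obtain ⟨a, b, hb, hbd⟩ := phi_bound hφ
  have hi : Integrable (fun x : ℝ => Real.exp (a - b * |x|)) := by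
    have := (integrable_exp_abs hb).const_mul (Real.exp a)
    refine this.congr (ae_of_all _ fun x => ?_)
    simp only [← Real.exp_add]; ring_nf
  refine lt_of_le_of_lt (lintegral_mono fun x => EReal.exp_monotone (hbd x)) ?_
  simp only [EReal.exp_coe]
  exact hi.lintegral_lt_top

noncomputable def Pm (φ : ℝ → EReal) : Measure ℝ := volume.withDensity (fun x => EReal.exp (φ x))

lemma Pm_prob {φ : ℝ → EReal} (hdens : (∫⁻ x, EReal.exp (φ x)) = 1) : IsProbabilityMeasure (Pm φ) :=
  ⟨by rw [Pm, withDensity_apply _ MeasurableSet.univ, Measure.restrict_univ, hdens]⟩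

lemma Pm_integrable_iff {φ : ℝ → EReal} (hφ : IsPhi φ) (g : ℝ → ℝ) :
    Integrable g (Pm φ) ↔ Integrable (fun x => g x * EReal.expR (φ x)) :=
  integrable_withDensity_iff (meas_exp hφ) (ae_of_all _ fun x => exp_lt_top_phi hφ x)

lemma Pm_cdf {φ : ℝ → EReal} (hφ : IsPhi φ) (t : ℝ) :
    (Pm φ (Iic t)).toReal = ∫ s in Iic t, EReal.expR (φ s) := by
  rw [Pm, withDensity_apply _ measurableSet_Iic]
  exact (integral_toReal (meas_exp hφ).aemeasurable (ae_of_all _ fun x => exp_lt_top_phi hφ x)).symm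

lemma meas_expR {φ : ℝ → EReal} (hφ : IsPhi φ) : Measurable (fun x => EReal.expR (φ x)) :=
  (meas_exp hφ).ennreal_toReal

lemma expR_nonneg (x : EReal) : 0 ≤ EReal.expR x := ENNReal.toReal_nonneg

lemma Pm_id {φ : ℝ → EReal} (hφ : IsPhi φ) : Integrable (fun x : ℝ => x) (Pm φ) := by
  rw [Pm_integrable_iff hφ]
  obtain ⟨a, b, hb, hbd⟩ := phi_bound hφ
  refine ((integrable_exp_abs (half_pos hb)).const_mul (2 / b * Real.exp a)).mono'
    ((measurable_id.mul (meas_expR hφ)).aestronglyMeasurable) (ae_of_all _ fun x => ?_)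
  rw [norm_mul, Real.norm_eq_abs, Real.norm_of_nonneg (expR_nonneg _)]
  have h1 := expR_le hφ (hbd x)
  have h2 : |x| ≤ 2 / b * Real.exp (b / 2 * |x|) := by
    have := Real.add_one_le_exp (b / 2 * |x|)
    have h3 : |x| = 2 / b * (b / 2 * |x|) := by field_simp
    conv_lhs => rw [h3]
    exact mul_le_mul_of_nonneg_left (by linarith) (by positivity)
  calc |x| * EReal.expR (φ x) ≤ (2 / b * Real.exp (b / 2 * |x|)) * Real.exp (a - b * |x|) :=
        mul_le_mul h2 h1 (expR_nonneg _) (by positivity)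
    _ = 2 / b * Real.exp a * Real.exp (-(b / 2) * |x|) := by
        rw [mul_assoc, ← Real.exp_add, mul_assoc, ← Real.exp_add]; ring_nf

lemma Pm_toReal {φ : ℝ → EReal} (hφ : IsPhi φ) : Integrable (fun x : ℝ => (φ x).toReal) (Pm φ) := by
  rw [Pm_integrable_iff hφ]
  obtain ⟨a, b, hb, hbd⟩ := phi_bound hφ
  set K := 2 + |a| * Real.exp (|a| / 2) with hK
  refine ((integrable_exp_abs (half_pos hb)).const_mul (K * Real.exp (a / 2))).mono'
    (((meas_phi hφ).ereal_toReal.mul (meas_expR hφ)).aestronglyMeasurable) (ae_of_all _ fun x => ?_)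
  rw [norm_mul, Real.norm_eq_abs, Real.norm_of_nonneg (expR_nonneg _)]
  by_cases hx : φ x = ⊥
  · rw [hx]; simp only [EReal.toReal_bot, abs_zero, zero_mul]; positivity
  rw [expR_real hφ hx]
  have hp := toReal_le_of hφ hx (hbd x)
  set p := (φ x).toReal
  have hpa : p ≤ a := by nlinarith [abs_nonneg x]
  have h1 : |p| * Real.exp (p / 2) ≤ K := by
    rcases le_total p 0 with h | h
    · rw [abs_of_nonpos h]
      have h2 := Real.add_one_le_exp (-(p / 2))
      have h3 : Real.exp (-(p/2)) * Real.exp (p / 2) = 1 := by rw [← Real.exp_add]; simp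
      have h4 : -p * Real.exp (p/2) ≤ (2 * Real.exp (-(p/2))) * Real.exp (p / 2) :=
        mul_le_mul_of_nonneg_right (by linarith) (Real.exp_pos _).le
      have : 0 ≤ |a| * Real.exp (|a| / 2) := by positivity
      rw [mul_assoc, h3] at h4
      rw [hK]; linarith
    · rw [abs_of_nonneg h]
      have h2 : p ≤ |a| := hpa.trans (le_abs_self a)
      have : p * Real.exp (p/2) ≤ |a| * Real.exp (|a| / 2) :=
        mul_le_mul h2 (Real.exp_le_exp.2 (by linarith)) (Real.exp_pos _).le (abs_nonneg a)
      rw [hK]; linarith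
  have h2 : Real.exp p = Real.exp (p/2) * Real.exp (p/2) := by rw [← Real.exp_add]; ring_nf
  have hKp : 0 ≤ K := by positivity
  calc |p| * Real.exp p = (|p| * Real.exp (p/2)) * Real.exp (p/2) := by rw [h2]; ring
    _ ≤ K * Real.exp (a / 2 + -(b / 2) * |x|) :=
        mul_le_mul h1 (Real.exp_le_exp.2 (by linarith)) (Real.exp_pos _).le hKp
    _ = K * Real.exp (a / 2) * Real.exp (-(b / 2) * |x|) := by rw [Real.exp_add]; ring

lemma Pm_ne_bot {φ : ℝ → EReal} (hφ : IsPhi φ) : ∀ᵐ x ∂(Pm φ), φ x ≠ ⊥ := by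
  rw [Pm, ae_withDensity_iff (meas_exp hφ)]
  exact ae_of_all _ fun x hx h => hx (by rw [h]; exact EReal.exp_bot)

lemma toENN_eq (x : EReal) : x.toENN = x.toENNReal := rfl

lemma kf_point {φ : ℝ → EReal} (hφ : IsPhi φ) {C : ℝ} (hC0 : 0 ≤ C) (hC : ∀ x, φ x ≤ (C : EReal))
    (x : ℝ) : (φ x).toENN + kf φ C x = ENNReal.ofReal C + (-(φ x)).toENN := by
  rw [toENN_eq, toENN_eq]
  by_cases hx : φ x = ⊥
  · rw [kf_bot hx, hx]; simp
  · rw [kf_real hφ hx]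
    have hp := toReal_le_of hφ hx (hC x)
    conv_lhs => rw [← coe_toReal_phi hφ hx, EReal.toReal_coe, EReal.real_coe_toENNReal]
    conv_rhs => rw [← coe_toReal_phi hφ hx, ← EReal.coe_neg, EReal.real_coe_toENNReal]
    rcases le_total (φ x).toReal 0 with h | h
    · rw [ENNReal.ofReal_of_nonpos h, zero_add, ← ENNReal.ofReal_add hC0 (by linarith)]
      ring_nf
    · rw [ENNReal.ofReal_of_nonpos (neg_nonpos.2 h), add_zero,
        ← ENNReal.ofReal_add h (by linarith)]
      ring_nf

lemma Lfun_eq {φ : ℝ → EReal} (hφ : IsPhi φ) {C : ℝ} (hC0 : 0 ≤ C) (hC : ∀ x, φ x ≤ (C : EReal))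
    (Q : Measure ℝ) [IsProbabilityMeasure Q] :
    Lfun φ Q = ((C + 1 : ℝ) : EReal) -
      ((∫⁻ x, kf φ C x ∂Q + ∫⁻ x, EReal.exp (φ x) : ℝ≥0∞) : EReal) := by
  have hE := lint_exp_lt_top hφ
  have hA : ∫⁻ x, (φ x).toENN ∂Q ≤ ENNReal.ofReal C := by
    calc ∫⁻ x, (φ x).toENN ∂Q ≤ ∫⁻ x, ENNReal.ofReal C ∂Q := by
          refine lintegral_mono fun x => ?_
          show (φ x).toENNReal ≤ _
          rw [← EReal.real_coe_toENNReal]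
          exact EReal.toENNReal_le_toENNReal (hC x)
      _ = _ := by simp
  have hAt : ∫⁻ x, (φ x).toENN ∂Q < ⊤ := hA.trans_lt ENNReal.ofReal_lt_top
  have hm : Measurable (fun x => (φ x).toENN) :=
    EReal.continuous_toENNReal.measurable.comp (meas_phi hφ)
  have hsum : ∫⁻ x, (φ x).toENN ∂Q + ∫⁻ x, kf φ C x ∂Q =
      ENNReal.ofReal C + ∫⁻ x, (-(φ x)).toENN ∂Q := by
    rw [← lintegral_add_left hm, lintegral_congr (kf_point hφ hC0 hC),
      lintegral_add_left measurable_const]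
    simp
  unfold Lfun eint
  generalize (∫⁻ x, (φ x).toENN ∂Q) = A at *
  generalize (∫⁻ x, (-(φ x)).toENN ∂Q) = N at *
  generalize (∫⁻ x, kf φ C x ∂Q) = W at *
  generalize (∫⁻ x, EReal.exp (φ x)) = E at *
  lift A to NNReal using hAt.ne
  lift E to NNReal using hE.ne
  by_cases hW : W = ⊤
  · have hN : N = ⊤ := by
      by_contra hN
      rw [hW, add_top] at hsum
      exact absurd hsum.symm (ENNReal.add_ne_top.2 ⟨ENNReal.ofReal_ne_top, hN⟩)
    subst hW hN
    simp
  · have hN : N ≠ ⊤ := by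
      rintro rfl
      rw [add_top] at hsum
      exact absurd hsum (ENNReal.add_ne_top.2 ⟨ENNReal.coe_ne_top, hW⟩)
    lift W to NNReal using hW
    lift N to NNReal using hN
    have h := congrArg ENNReal.toReal hsum
    rw [ENNReal.toReal_add (by simp) (by simp), ENNReal.toReal_add (by simp) (by simp),
      ENNReal.toReal_ofReal hC0] at h
    simp only [ENNReal.coe_toReal] at h
    have : ((((A:ℝ) - N) - E + 1 : ℝ) : EReal) = (((C + 1) - (W + E) : ℝ) : EReal) := by
      rw [EReal.coe_eq_coe_iff]; linarith
    rw [← ENNReal.coe_add, EReal.coe_nnreal_eq_coe_real, EReal.coe_nnreal_eq_coe_real,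
      EReal.coe_nnreal_eq_coe_real, EReal.coe_nnreal_eq_coe_real, NNReal.coe_add]
    rw [← EReal.coe_one, ← EReal.coe_sub, ← EReal.coe_sub, ← EReal.coe_add, ← EReal.coe_sub]
    exact this

lemma ereal_cancel (c : ℝ) (X Y : ℝ≥0∞) :
    ((c : EReal) - (X : EReal) ≤ (c : EReal) - (Y : EReal)) ↔ Y ≤ X := by
  constructor
  · intro h
    by_cases hX : X = ⊤
    · rw [hX]; exact le_top
    by_cases hY : Y = ⊤
    · exfalso
      lift X to NNReal using hX
      rw [hY, EReal.coe_nnreal_eq_coe_real, ← EReal.coe_sub] at h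
      rw [EReal.coe_ennreal_top, EReal.sub_top] at h
      exact absurd (le_bot_iff.1 h) (EReal.coe_ne_bot _)
    lift X to NNReal using hX
    lift Y to NNReal using hY
    rw [EReal.coe_nnreal_eq_coe_real, EReal.coe_nnreal_eq_coe_real, ← EReal.coe_sub, ← EReal.coe_sub,
      EReal.coe_le_coe_iff] at h
    have : (Y : ℝ) ≤ X := by linarith
    exact_mod_cast this
  · intro h
    exact EReal.sub_le_sub le_rfl (EReal.coe_ennreal_le_coe_ennreal_iff.2 h)

lemma const_bound {φ : ℝ → EReal} (hφ : IsPhi φ) : ∃ C : ℝ, 0 ≤ C ∧ ∀ x, φ x ≤ (C : EReal) := by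
  obtain ⟨a, b, hb, h⟩ := phi_bound hφ
  refine ⟨max a 0, le_max_right _ _, fun x => (h x).trans ?_⟩
  rw [EReal.coe_le_coe_iff]
  have := mul_nonneg hb.le (abs_nonneg x)
  linarith [le_max_left a 0]

lemma const_bound2 {φ ψ : ℝ → EReal} (hφ : IsPhi φ) (hψ : IsPhi ψ) :
    ∃ C : ℝ, 0 ≤ C ∧ (∀ x, φ x ≤ (C : EReal)) ∧ ∀ x, ψ x ≤ (C : EReal) := by
  obtain ⟨C, h0, h⟩ := const_bound hφ
  obtain ⟨D, h0', h'⟩ := const_bound hψ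
  exact ⟨max C D, h0.trans (le_max_left _ _),
    fun x => (h x).trans (EReal.coe_le_coe_iff.2 (le_max_left _ _)),
    fun x => (h' x).trans (EReal.coe_le_coe_iff.2 (le_max_right _ _))⟩

lemma Lfun_le_iff {φ ψ : ℝ → EReal} (hφ : IsPhi φ) (hψ : IsPhi ψ) {C : ℝ} (hC0 : 0 ≤ C)
    (hC : ∀ x, φ x ≤ (C : EReal)) (hC' : ∀ x, ψ x ≤ (C : EReal))
    (Q : Measure ℝ) [IsProbabilityMeasure Q] :
    Lfun ψ Q ≤ Lfun φ Q ↔ ∫⁻ x, kf φ C x ∂Q + ∫⁻ x, EReal.exp (φ x) ≤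
      ∫⁻ x, kf ψ C x ∂Q + ∫⁻ x, EReal.exp (ψ x) := by
  rw [Lfun_eq hφ hC0 hC, Lfun_eq hψ hC0 hC', ereal_cancel]

lemma mle_finite {φ : ℝ → EReal} (Q : Measure ℝ) [IsProbabilityMeasure Q]
    (hQ : Integrable (fun x : ℝ => x) Q) (h : IsMLE Q φ) {C : ℝ} (hC0 : 0 ≤ C)
    (hC : ∀ x, φ x ≤ (C : EReal)) : ∫⁻ x, kf φ C x ∂Q < ⊤ := by
  have h1 := (Lfun_le_iff h.1 isPhi_neg_abs hC0 hC (fun x => by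
    rw [EReal.coe_le_coe_iff]; linarith [abs_nonneg x]) Q).1 (h.2 _ isPhi_neg_abs)
  refine lt_of_le_of_lt (le_self_add.trans h1) (ENNReal.add_lt_top.2 ⟨?_, lint_exp_lt_top isPhi_neg_abs⟩)
  have e : ∀ x, kf (fun x : ℝ => ((-|x| : ℝ) : EReal)) C x = ENNReal.ofReal (C + |x|) := by
    intro x
    rw [kf_real isPhi_neg_abs (EReal.coe_ne_bot _), EReal.toReal_coe]; ring_nf
  simp_rw [e]
  exact ((integrable_const C).add hQ.abs).lintegral_lt_top

lemma mle_ae {φ : ℝ → EReal} (Q : Measure ℝ) [IsProbabilityMeasure Q] (hφ : IsPhi φ) {C : ℝ}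
    (hC : ∀ x, φ x ≤ (C : EReal)) (h : ∫⁻ x, kf φ C x ∂Q < ⊤) :
    (∀ᵐ x ∂Q, φ x ≠ ⊥) ∧ Integrable (fun x => C - (φ x).toReal) Q ∧
      ∫⁻ x, kf φ C x ∂Q = ENNReal.ofReal (∫ x, (C - (φ x).toReal) ∂Q) := by
  have h1 : ∀ᵐ x ∂Q, φ x ≠ ⊥ := by
    filter_upwards [ae_lt_top (meas_kf hφ C) h.ne] with x hx hb
    rw [kf_bot hb] at hx; exact lt_irrefl _ hx
  have h2 : ∫⁻ x, kf φ C x ∂Q = ∫⁻ x, ENNReal.ofReal (C - (φ x).toReal) ∂Q := by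
    refine lintegral_congr_ae ?_
    filter_upwards [h1] with x hx
    exact kf_real hφ hx
  have h3 : 0 ≤ᵐ[Q] fun x => C - (φ x).toReal := by
    filter_upwards [h1] with x hx
    exact sub_nonneg.2 (toReal_le_of hφ hx (hC x))
  have h4 : Integrable (fun x => C - (φ x).toReal) Q := by
    refine ⟨(measurable_const.sub (meas_phi hφ).ereal_toReal).aestronglyMeasurable, ?_⟩
    rw [hasFiniteIntegral_iff_ofReal h3, ← h2]; exact h
  exact ⟨h1, h4, by rw [h2, ofReal_integral_eq_lintegral_ofReal h4 h3]⟩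

lemma perturb_step {φ : ℝ → EReal} (Q : Measure ℝ) [IsProbabilityMeasure Q]
    (hQ : Integrable (fun x : ℝ => x) Q) (h : IsMLE Q φ) (hdens : (∫⁻ x, EReal.exp (φ x)) = 1)
    (w : ℝ → ℝ) (hw : Measurable w) (hwQ : Integrable w Q)
    (hp : IsPhi (fun x => φ x + ((w x : ℝ) : EReal))) :
    Integrable (fun x => Real.exp (w x)) (Pm φ) ∧ ∫ x, w x ∂Q + 1 ≤ ∫ x, Real.exp (w x) ∂(Pm φ) := by
  obtain ⟨C, hC0, hC, hC'⟩ := const_bound2 h.1 hp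
  have hle := (Lfun_le_iff h.1 hp hC0 hC hC' Q).1 (h.2 _ hp)
  have hfin := mle_finite Q hQ h hC0 hC
  obtain ⟨a1, a2, a3⟩ := mle_ae Q h.1 hC hfin
  have hE : ∫⁻ x, EReal.exp (φ x + ((w x : ℝ) : EReal)) = ∫⁻ x, ENNReal.ofReal (Real.exp (w x)) ∂(Pm φ) := by
    rw [Pm, lintegral_withDensity_eq_lintegral_mul _ (meas_exp h.1) (by fun_prop)]
    refine lintegral_congr fun x => ?_
    rw [EReal.exp_add, EReal.exp_coe]; rfl
  have hEt := lint_exp_lt_top hp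
  have hnn : 0 ≤ᵐ[Pm φ] fun x => Real.exp (w x) := ae_of_all _ fun x => (Real.exp_pos _).le
  have hi : Integrable (fun x => Real.exp (w x)) (Pm φ) := by
    refine ⟨(Real.measurable_exp.comp hw).aestronglyMeasurable, ?_⟩
    rw [hasFiniteIntegral_iff_ofReal hnn, ← hE]; exact hEt
  refine ⟨hi, ?_⟩
  have hpb : ∀ x, φ x ≠ ⊥ → (φ x + ((w x : ℝ) : EReal)) ≠ ⊥ ∧
      (φ x + ((w x : ℝ) : EReal)).toReal = (φ x).toReal + w x := by
    intro x hx
    refine ⟨?_, ?_⟩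
    · rw [Ne, EReal.add_eq_bot_iff]; push Not; exact ⟨hx, EReal.coe_ne_bot _⟩
    · rw [EReal.toReal_add (h.1.2.1 x) hx (EReal.coe_ne_top _) (EReal.coe_ne_bot _), EReal.toReal_coe]
  have hW : ∫⁻ x, kf (fun x => φ x + ((w x : ℝ) : EReal)) C x ∂Q =
      ENNReal.ofReal (∫ x, (C - (φ x).toReal - w x) ∂Q) := by
    rw [ofReal_integral_eq_lintegral_ofReal (f := fun x => C - (φ x).toReal - w x) (a2.sub hwQ)]
    · refine lintegral_congr_ae ?_
      filter_upwards [a1] with x hx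
      rw [kf_real hp (hpb x hx).1, (hpb x hx).2, sub_sub]
    · filter_upwards [a1] with x hx
      have := toReal_le_of hp (hpb x hx).1 (hC' x)
      rw [(hpb x hx).2] at this
      show (0:ℝ) ≤ C - (φ x).toReal - w x
      linarith
  have hnn2 : 0 ≤ ∫ x, (C - (φ x).toReal - w x) ∂Q := by
    refine integral_nonneg_of_ae ?_
    filter_upwards [a1] with x hx
    have := toReal_le_of hp (hpb x hx).1 (hC' x)
    rw [(hpb x hx).2] at this
    show (0:ℝ) ≤ C - (φ x).toReal - w x
    linarith
  have hnn3 : 0 ≤ ∫ x, (C - (φ x).toReal) ∂Q := by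
    refine integral_nonneg_of_ae ?_
    filter_upwards [a1] with x hx
    exact sub_nonneg.2 (toReal_le_of h.1 hx (hC x))
  have hnn4 : 0 ≤ ∫ x, Real.exp (w x) ∂(Pm φ) := integral_nonneg fun x => (Real.exp_pos _).le
  rw [hE, hdens, a3, hW, ← ofReal_integral_eq_lintegral_ofReal hi hnn, ← ENNReal.ofReal_one,
    ← ENNReal.ofReal_add hnn3 zero_le_one, ← ENNReal.ofReal_add hnn2 hnn4,
    ENNReal.ofReal_le_ofReal_iff (by linarith), integral_sub a2 hwQ] at hle
  linarith

lemma exp_quot_bounds (d t t0 : ℝ) (ht : 0 < t) (htt : t ≤ t0) :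
    d ≤ (Real.exp (t * d) - 1) / t ∧ (Real.exp (t * d) - 1) / t ≤ (Real.exp (t0 * d) - 1) / t0 := by
  have ht0 := ht.trans_le htt
  constructor
  · rw [le_div_iff₀ ht]
    linarith [Real.add_one_le_exp (t * d)]
  · rw [div_le_div_iff₀ ht ht0]
    have := convexOn_exp.2 (mem_univ 0) (mem_univ (t0 * d))
      (sub_nonneg.2 ((div_le_one ht0).2 htt)) (by positivity : 0 ≤ t / t0) (by ring)
    simp only [smul_eq_mul, mul_zero, zero_add, Real.exp_zero, mul_one] at this
    have e : t / t0 * (t0 * d) = t * d := by field_simp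
    rw [e] at this
    have h2 := mul_le_mul_of_nonneg_right this ht0.le
    have e2 : (1 - t / t0 + t / t0 * Real.exp (t0 * d)) * t0 = t0 - t + t * Real.exp (t0 * d) := by
      field_simp
    rw [e2] at h2
    linarith

lemma perturb {φ : ℝ → EReal} (Q : Measure ℝ) [IsProbabilityMeasure Q]
    (hQ : Integrable (fun x : ℝ => x) Q) (h : IsMLE Q φ) (hdens : (∫⁻ x, EReal.exp (φ x)) = 1)
    (d : ℝ → ℝ) (hd : Measurable d) (hdQ : Integrable d Q) (hdP : Integrable d (Pm φ))
    (t0 : ℝ) (ht0 : 0 < t0)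
    (hp : ∀ t, 0 < t → t ≤ t0 → IsPhi (fun x => φ x + ((t * d x : ℝ) : EReal))) :
    ∫ x, d x ∂Q ≤ ∫ x, d x ∂(Pm φ) := by
  have := Pm_prob hdens
  have step : ∀ t, 0 < t → t ≤ t0 → Integrable (fun x => Real.exp (t * d x)) (Pm φ) ∧
      t * ∫ x, d x ∂Q + 1 ≤ ∫ x, Real.exp (t * d x) ∂(Pm φ) := by
    intro t h1 h2
    have := perturb_step Q hQ h hdens (fun x => t * d x) (hd.const_mul t) (hdQ.const_mul t) (hp t h1 h2)
    rwa [integral_const_mul] at this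
  set tn : ℕ → ℝ := fun n => t0 / ((n : ℝ) + 1) with htn
  have htpos : ∀ n, 0 < tn n := fun n => by positivity
  have htle : ∀ n, tn n ≤ t0 := fun n => div_le_self ht0.le (by linarith [Nat.cast_nonneg (α := ℝ) n])
  have htlim : Tendsto tn atTop (𝓝 0) := by
    have := (tendsto_one_div_add_atTop_nhds_zero_nat (𝕜 := ℝ)).const_mul t0
    simpa [htn, div_eq_mul_inv] using this
  have htlim' : Tendsto tn atTop (𝓝[≠] 0) :=
    tendsto_nhdsWithin_iff.2 ⟨htlim, Eventually.of_forall fun n => (htpos n).ne'⟩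
  have hlim : Tendsto (fun n => ∫ x, (Real.exp (tn n * d x) - 1) / tn n ∂(Pm φ)) atTop
      (𝓝 (∫ x, d x ∂(Pm φ))) := by
    refine tendsto_integral_of_dominated_convergence
      (fun x => |d x| + |(Real.exp (t0 * d x) - 1) / t0|) (fun n => ?_) ?_ (fun n => ?_) ?_
    · exact Measurable.aestronglyMeasurable (by fun_prop)
    · exact hdP.abs.add ((((step t0 ht0 le_rfl).1.sub (integrable_const 1)).div_const t0).abs)
    · refine ae_of_all _ fun x => ?_
      obtain ⟨b1, b2⟩ := exp_quot_bounds (d x) (tn n) t0 (htpos n) (htle n)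
      rw [Real.norm_eq_abs, abs_le]
      constructor
      · linarith [neg_abs_le (d x), abs_nonneg ((Real.exp (t0 * d x) - 1) / t0)]
      · linarith [le_abs_self ((Real.exp (t0 * d x) - 1) / t0), abs_nonneg (d x)]
    · refine ae_of_all _ fun x => ?_
      have hder : HasDerivAt (fun s : ℝ => Real.exp (s * d x)) (d x) 0 := by
        have := ((hasDerivAt_id (0:ℝ)).mul_const (d x)).exp
        simpa using this
      have := hder.tendsto_slope_zero.comp htlim'
      refine this.congr fun n => ?_
      simp [div_eq_inv_mul]
  refine ge_of_tendsto hlim (Eventually.of_forall fun n => ?_)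
  obtain ⟨i1, i2⟩ := step (tn n) (htpos n) (htle n)
  rw [integral_div, integral_sub i1 (integrable_const 1), le_div_iff₀ (htpos n)]
  simp
  linarith

lemma perturb_concave {φ : ℝ → EReal} (Q : Measure ℝ) [IsProbabilityMeasure Q]
    (hQ : Integrable (fun x : ℝ => x) Q) (h : IsMLE Q φ) (hdens : (∫⁻ x, EReal.exp (φ x)) = 1)
    (d : ℝ → ℝ) (hd : Continuous d) (hdc : ConcaveOn ℝ univ d) (hdb : ∀ x, d x ≤ |x|)
    (hdQ : Integrable d Q) (hdP : Integrable d (Pm φ)) :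
    ∫ x, d x ∂Q ≤ ∫ x, d x ∂(Pm φ) := by
  obtain ⟨a, b, hb, hbd⟩ := phi_bound h.1
  refine perturb Q hQ h hdens d hd.measurable hdQ hdP (b / 2) (half_pos hb) fun t ht htb => ?_
  refine isPhi_add h.1 hbd (fun x => t * d x) (by fun_prop) ?_ 0 (b / 2) (half_lt_self hb) ?_
  · have := hdc.smul ht.le
    simpa [smul_eq_mul] using this
  · intro x
    rw [zero_add]
    exact (mul_le_mul_of_nonneg_left (hdb x) ht.le).trans
      (mul_le_mul_of_nonneg_right htb (abs_nonneg x))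

lemma concave_min (x : ℝ) : ConcaveOn ℝ univ (fun y : ℝ => min (y - x) 0) := by
  refine ⟨convex_univ, fun y _ z _ a b ha hb hab => ?_⟩
  simp only [smul_eq_mul]
  refine le_min ?_ ?_
  · have h1 := mul_le_mul_of_nonneg_left (min_le_left (y - x) 0) ha
    have h2 := mul_le_mul_of_nonneg_left (min_le_left (z - x) 0) hb
    have h3 : a * x + b * x = x := by rw [← add_mul, hab, one_mul]
    linarith
  · have h1 := mul_nonpos_of_nonneg_of_nonpos ha (min_le_right (y - x) 0)
    have h2 := mul_nonpos_of_nonneg_of_nonpos hb (min_le_right (z - x) 0)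
    linarith

lemma primitive_nbhd (D : ℝ → ℝ) (hD : Integrable D) (x : ℝ) (hx : ∫ t in Iic x, D t < 0) :
    ∃ δ ε : ℝ, 0 < δ ∧ 0 < ε ∧ ∀ y ∈ Icc (x - δ) (x + δ), ∫ t in Iic y, D t ≤ -ε := by
  have hc : Continuous (fun y => ∫ t in x..y, D t) :=
    intervalIntegral.continuous_primitive (fun a b => hD.intervalIntegrable) x
  have h0 : (fun y => ∫ t in x..y, D t) x < -(∫ t in Iic x, D t) / 2 := by
    simp only [intervalIntegral.integral_same]; linarith
  obtain ⟨δ, hδ, hb⟩ := Metric.eventually_nhds_iff.1 (hc.continuousAt.eventually (gt_mem_nhds h0))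
  refine ⟨δ / 2, -(∫ t in Iic x, D t) / 2, half_pos hδ, by linarith, fun y hy => ?_⟩
  have h1 : dist y x < δ := by
    rw [Real.dist_eq, abs_lt]; constructor <;> linarith [hy.1, hy.2]
  have h2 := hb h1
  have h3 := intervalIntegral.integral_Iic_sub_Iic (f := D) (μ := volume) (a := x) (b := y)
    hD.integrableOn hD.integrableOn
  rw [← h3] at h2
  linarith

lemma exp_kf_point {φ ψ : ℝ → EReal} (hφ : IsPhi φ) (hψ : IsPhi ψ) {C : ℝ}
    (hC : ∀ x, φ x ≤ (C : EReal)) (hC' : ∀ x, ψ x ≤ (C : EReal)) (x : ℝ) :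
    EReal.exp (φ x) * kf φ C x + EReal.exp (φ x) ≤ EReal.exp (φ x) * kf ψ C x + EReal.exp (ψ x) := by
  by_cases hx : φ x = ⊥
  · simp [hx]
  by_cases hy : ψ x = ⊥
  · rw [kf_bot hy, ENNReal.mul_top, top_add]
    · exact le_top
    · rw [Ne, EReal.exp_eq_zero_iff]; exact hx
  rw [kf_real hφ hx, kf_real hψ hy]
  have e1 : EReal.exp (φ x) = ENNReal.ofReal (Real.exp (φ x).toReal) := by
    conv_lhs => rw [← coe_toReal_phi hφ hx, EReal.exp_coe]
  have e2 : EReal.exp (ψ x) = ENNReal.ofReal (Real.exp (ψ x).toReal) := by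
    conv_lhs => rw [← coe_toReal_phi hψ hy, EReal.exp_coe]
  rw [e1, e2]
  have hp := toReal_le_of hφ hx (hC x)
  have hq := toReal_le_of hψ hy (hC' x)
  generalize (φ x).toReal = p at *
  generalize (ψ x).toReal = q at *
  have hep := Real.exp_pos p
  have heq := Real.exp_pos q
  rw [← ENNReal.ofReal_mul hep.le, ← ENNReal.ofReal_mul hep.le,
    ← ENNReal.ofReal_add (mul_nonneg hep.le (by linarith)) hep.le,
    ← ENNReal.ofReal_add (mul_nonneg hep.le (by linarith)) heq.le]
  apply ENNReal.ofReal_le_ofReal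
  have h1 := mul_le_mul_of_nonneg_left (Real.add_one_le_exp (q - p)) hep.le
  rw [← Real.exp_add, add_sub_cancel] at h1
  nlinarith

lemma backward_mid {φ ψ : ℝ → EReal} (hφ : IsPhi φ) (hψ : IsPhi ψ) {C : ℝ}
    (hC : ∀ x, φ x ≤ (C : EReal)) (hC' : ∀ x, ψ x ≤ (C : EReal)) :
    ∫⁻ x, kf φ C x ∂(Pm φ) + ∫⁻ x, EReal.exp (φ x) ≤
      ∫⁻ x, kf ψ C x ∂(Pm φ) + ∫⁻ x, EReal.exp (ψ x) := by
  rw [Pm, lintegral_withDensity_eq_lintegral_mul _ (meas_exp hφ) (meas_kf hφ C),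
    lintegral_withDensity_eq_lintegral_mul _ (meas_exp hφ) (meas_kf hψ C),
    ← lintegral_add_right _ (meas_exp hφ), ← lintegral_add_right _ (meas_exp hψ)]
  exact lintegral_mono fun x => exp_kf_point hφ hψ hC hC' x

lemma exists_ne_bot {φ : ℝ → EReal} (hdens : (∫⁻ x, EReal.exp (φ x)) = 1) : ∃ z, φ z ≠ ⊥ := by
  by_contra h
  push Not at h
  simp [h] at hdens

lemma mle_contact {φ : ℝ → EReal} (Q : Measure ℝ) [IsProbabilityMeasure Q]
    (hQ : Integrable (fun x : ℝ => x) Q) (h : IsMLE Q φ) (hdens : (∫⁻ x, EReal.exp (φ x)) = 1)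
    (h0 : ∫ t, ((Pm φ (Iic t)).toReal - (Q (Iic t)).toReal) = 0)
    (hH : ∀ x, ∫ t in Iic x, ((Pm φ (Iic t)).toReal - (Q (Iic t)).toReal) ≤ 0)
    (x : ℝ) (hxb : φ x ≠ ⊥) (hxS : ∀ δ : ℝ, 0 < δ → φ (x - δ) + φ (x + δ) < φ x + φ x) :
    ∫ t in Iic x, ((Pm φ (Iic t)).toReal - (Q (Iic t)).toReal) = 0 := by
  have := Pm_prob hdens
  have hP := Pm_id h.1
  by_contra hne
  have hlt := lt_of_le_of_ne (hH x) hne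
  obtain ⟨δ, ε, hδ, hε, hy⟩ := primitive_nbhd _ (cdf_diff_integrable (Pm φ) Q hP hQ) x hlt
  obtain ⟨C, hC0, hC⟩ := const_bound h.1
  obtain ⟨ε', hε', hs⟩ := kf_order_strict (Pm φ) Q hP hQ h0 hH h.1 hC (exists_ne_bot hdens) x δ ε hδ hε
    hy hxb (hxS δ hδ)
  have hfin := mle_finite Q hQ h hC0 hC
  have hfinP : ∫⁻ x, kf φ C x ∂(Pm φ) < ⊤ := (le_self_add.trans hs).trans_lt hfin
  obtain ⟨_, a2, a3⟩ := mle_ae Q h.1 hC hfin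
  obtain ⟨_, b2, b3⟩ := mle_ae (Pm φ) h.1 hC hfinP
  have hpQ : Integrable (fun x => -(φ x).toReal) Q := by
    refine (a2.sub (integrable_const C)).congr (ae_of_all _ fun x => ?_)
    simp
  have hpP : Integrable (fun x => -(φ x).toReal) (Pm φ) := (Pm_toReal h.1).neg
  have key := perturb Q hQ h hdens (fun x => -(φ x).toReal) (meas_phi h.1).ereal_toReal.neg hpQ hpP
    (1 / 2) (by norm_num) (fun t _ ht => isPhi_scale h.1 t (by linarith))
  have e1 : ∫ x, (C - (φ x).toReal) ∂Q = C + ∫ x, -(φ x).toReal ∂Q := by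
    rw [show (fun x => C - (φ x).toReal) = fun x => C + -(φ x).toReal from by
      funext x; ring, integral_add (integrable_const C) hpQ]; simp
  have e2 : ∫ x, (C - (φ x).toReal) ∂(Pm φ) = C + ∫ x, -(φ x).toReal ∂(Pm φ) := by
    rw [show (fun x => C - (φ x).toReal) = fun x => C + -(φ x).toReal from by
      funext x; ring, integral_add (integrable_const C) hpP]; simp
  have h1 : ∫⁻ x, kf φ C x ∂Q ≤ ∫⁻ x, kf φ C x ∂(Pm φ) := by
    rw [a3, b3]; exact ENNReal.ofReal_le_ofReal (by rw [e1, e2]; linarith)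
  have h2 := hs.trans h1
  have h3 : ∫⁻ x, kf φ C x ∂(Pm φ) < ∫⁻ x, kf φ C x ∂(Pm φ) + ENNReal.ofReal ε' :=
    ENNReal.lt_add_right hfinP.ne (by simpa using hε')
  exact absurd h3 (not_lt.2 h2)


/-- **Theorem 2 (characterization for d = 1).** Let `Q` be a nondegenerate distribution on `ℝ`
with finite first moment and c.d.f. `G`, and let `F` be the c.d.f. with log-density
`φ ∈ Φ(1)`. Then `φ = ψ(·|Q)` iff `∫ (F - G) dt = 0` over `ℝ`, `∫_{-∞}^x (F - G) dt ≤ 0`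
for all `x`, with equality for all `x ∈ S(φ)`. -/
theorem MLE_characterization_dim_one
    (Q : Measure ℝ) [IsProbabilityMeasure Q]
    (hnd : ∀ a : ℝ, Q ≠ Measure.dirac a) (hmom : (∫⁻ x, (‖x‖₊ : ℝ≥0∞) ∂Q) ≠ ⊤)
    (φ : ℝ → EReal) (hφ : IsPhi φ) (hdens : (∫⁻ x, EReal.exp (φ x)) = 1) :
    IsMLE Q φ ↔
      ((∫ t, ((∫ s in Set.Iic t, EReal.expR (φ s)) - (Q (Set.Iic t)).toReal)) = 0 ∧
       (∀ x : ℝ,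
         (∫ t in Set.Iic x, ((∫ s in Set.Iic t, EReal.expR (φ s)) - (Q (Set.Iic t)).toReal)) ≤ 0) ∧
       (∀ x : ℝ, (φ x ≠ ⊥ ∧ ∀ δ : ℝ, 0 < δ → φ (x - δ) + φ (x + δ) < φ x + φ x) →
         (∫ t in Set.Iic x, ((∫ s in Set.Iic t, EReal.expR (φ s)) - (Q (Set.Iic t)).toReal)) = 0)) := by
  have hP' := Pm_prob hdens
  have hP := Pm_id hφ
  have hQ : Integrable (fun x : ℝ => x) Q :=
    ⟨measurable_id.aestronglyMeasurable, lt_top_iff_ne_top.2 hmom⟩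
  simp_rw [← Pm_cdf hφ]
  constructor
  · intro h
    have m1 := perturb_concave Q hQ h hdens (fun y => y) continuous_id (concaveOn_id convex_univ)
      (fun x => le_abs_self x) hQ hP
    have m2 := perturb_concave Q hQ h hdens (fun y => -y) continuous_neg
      (convexOn_id convex_univ).neg (fun x => neg_le_abs x) hQ.neg hP.neg
    rw [integral_neg, integral_neg] at m2
    have h0 : ∫ t, ((Pm φ (Iic t)).toReal - (Q (Iic t)).toReal) = 0 := by
      rw [← mean_diff (Pm φ) Q hP hQ]; linarith
    have hH : ∀ x, ∫ t in Iic x, ((Pm φ (Iic t)).toReal - (Q (Iic t)).toReal) ≤ 0 := by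
      intro x
      obtain ⟨i1, i2, i3⟩ := hinge_diff (Pm φ) Q hP hQ x
      rw [← i3]
      have := perturb_concave Q hQ h hdens (fun y => min (y - x) 0) (by fun_prop) (concave_min x)
        (fun y => (min_le_right _ _).trans (abs_nonneg y)) i2 i1
      linarith
    exact ⟨h0, hH, fun x hx => mle_contact Q hQ h hdens h0 hH x hx.1 hx.2⟩
  · rintro ⟨h0, hH, hS⟩
    refine ⟨hφ, fun ψ hψ => ?_⟩
    obtain ⟨C, hC0, hC, hC'⟩ := const_bound2 hφ hψ
    rw [Lfun_le_iff hφ hψ hC0 hC hC']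
    by_cases hne : ∃ z, ψ z ≠ ⊥
    · have h1 := kf_order_eq (Pm φ) Q hP hQ h0 hφ hC (exists_ne_bot hdens) hS
      have h2 := kf_order (Pm φ) Q hP hQ h0 hH hψ hC' hne
      rw [← h1]
      exact (backward_mid hφ hψ hC hC').trans (add_le_add h2 le_rfl)
    · push Not at hne
      have : ∫⁻ x, kf ψ C x ∂Q = ⊤ := by
        rw [lintegral_congr fun x => kf_bot (hne x)]; simp
      rw [this, top_add]; exact le_top
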